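/- Let P ⊆ ℝ² be a simple polygon region with vertices v₁, …, vₙ, let [u,w] be a chord of P (that is, u, w lie on the frontier of P and [u,w] ∖ {u,w} is contained in the interior of P), and suppose P is weakly visible from the chord [u,w], i.e., every point of P is seen in P from some point of [u,w]. Let G be a finite set of points of the frontier of P that guards the frontier of P. Then there exists a set G' ⊆ {v₁, …, vₙ} ∪ {u, w} with |G'| ≤ 2|G| such that G ∪ G' guards all of P, i.e., every point of P is seen in P from some point of G ∪ G'. -/

import Mathlib

/-- `P` is a simple polygon region with the `n` vertices `v 0, …, v (n-1)`:
a compact subset of the plane with nonempty interior, equal to the closure of its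
interior, whose frontier is the union of the `n` edges `[v i, v (i+1)]` (indices
mod `n`), such that consecutive edges meet exactly in their common vertex and
non-consecutive edges are disjoint. -/
def IsSimplePolygonRegion {n : ℕ} [NeZero n]
    (P : Set (EuclideanSpace ℝ (Fin 2))) (v : Fin n → EuclideanSpace ℝ (Fin 2)) : Prop :=
  3 ≤ n ∧ Function.Injective v ∧ IsCompact P ∧ (interior P).Nonempty ∧
  P = closure (interior P) ∧
  frontier P = ⋃ i : Fin n, segment ℝ (v i) (v (i + 1)) ∧
  (∀ i : Fin n, segment ℝ (v i) (v (i + 1)) ∩ segment ℝ (v (i + 1)) (v (i + 1 + 1))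
      = {v (i + 1)}) ∧
  (∀ i j : Fin n, i ≠ j → j ≠ i + 1 → i ≠ j + 1 →
    Disjoint (segment ℝ (v i) (v (i + 1))) (segment ℝ (v j) (v (j + 1))))

section Helpers


/-- `a` sees `b` in `K`. -/
def Sees (K : Set (ℝ × ℝ)) (a b : ℝ × ℝ) : Prop := segment ℝ a b ⊆ K

/-- signed doubled area of the triangle `a b c`. -/
def dt (a b c : ℝ × ℝ) : ℝ := (b.1 - a.1) * (c.2 - a.2) - (b.2 - a.2) * (c.1 - a.1)

/-- Quadrilateral property (a consequence of `K` having no holes). -/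
def Quad (K : Set (ℝ × ℝ)) : Prop := ∀ a b c d, dt a c b * dt a c d < 0 →
  Sees K a b → Sees K b c → Sees K c d → Sees K d a → Sees K a c

theorem seg_iff {a b z : ℝ × ℝ} : z ∈ segment ℝ a b ↔
    ∃ θ : ℝ, 0 ≤ θ ∧ θ ≤ 1 ∧ z.1 = a.1 + θ * (b.1 - a.1) ∧ z.2 = a.2 + θ * (b.2 - a.2) := by
  constructor
  · rintro ⟨x, y, hx, hy, hxy, rfl⟩
    refine ⟨y, hy, by linarith, ?_, ?_⟩ <;> simp <;> rw [show x = 1 - y by linarith] <;> ring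
  · rintro ⟨θ, h0, h1, e1, e2⟩
    refine ⟨1 - θ, θ, by linarith, h0, by ring, ?_⟩
    ext <;> simp [e1, e2] <;> ring

theorem Sees.symm {K : Set (ℝ × ℝ)} {a b : ℝ × ℝ} (h : Sees K a b) : Sees K b a := by
  unfold Sees at *; rwa [segment_symm]

theorem Sees.left {K : Set (ℝ × ℝ)} {a b : ℝ × ℝ} (h : Sees K a b) : a ∈ K :=
  h (left_mem_segment ℝ a b)

theorem Sees.right {K : Set (ℝ × ℝ)} {a b : ℝ × ℝ} (h : Sees K a b) : b ∈ K :=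
  h (right_mem_segment ℝ a b)

theorem Sees.sub {K : Set (ℝ × ℝ)} {a b c d : ℝ × ℝ} (h : Sees K a b)
    (hc : c ∈ segment ℝ a b) (hd : d ∈ segment ℝ a b) : Sees K c d :=
  ((convex_segment a b).segment_subset hc hd).trans h

theorem dt_cont (a b : ℝ × ℝ) : Continuous (fun z => dt a b z) := by
  unfold dt; fun_prop

theorem seg_of_bary {a b c z : ℝ × ℝ} (hD : 0 < dt a b c) (h1 : dt b c z = 0)
    (h2 : 0 ≤ dt c a z) (h3 : 0 ≤ dt a b z) : z ∈ segment ℝ b c := by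
  have hs : dt b c z + dt c a z + dt a b z = dt a b c := by unfold dt; ring
  have e1 : dt a b c * z.1 = dt b c z * a.1 + dt c a z * b.1 + dt a b z * c.1 := by
    unfold dt; ring
  have e2 : dt a b c * z.2 = dt b c z * a.2 + dt c a z * b.2 + dt a b z * c.2 := by
    unfold dt; ring
  rw [seg_iff]
  refine ⟨dt a b z / dt a b c, by positivity, ?_, ?_, ?_⟩
  · rw [div_le_one hD]; linarith
  · field_simp; rw [h1] at e1 hs; rw [mul_comm, e1, ← hs]; ring
  · field_simp; rw [h1] at e2 hs; rw [mul_comm, e2, ← hs]; ring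

theorem hull_of_bary {a b c z : ℝ × ℝ} (hD : 0 < dt a b c) (h1 : 0 ≤ dt b c z)
    (h2 : 0 ≤ dt c a z) (h3 : 0 ≤ dt a b z) : z ∈ convexHull ℝ ({a, b, c} : Set (ℝ × ℝ)) := by
  have hs : dt b c z + dt c a z + dt a b z = dt a b c := by unfold dt; ring
  have e1 : dt a b c * z.1 = dt b c z * a.1 + dt c a z * b.1 + dt a b z * c.1 := by
    unfold dt; ring
  have e2 : dt a b c * z.2 = dt b c z * a.2 + dt c a z * b.2 + dt a b z * c.2 := by
    unfold dt; ring
  rw [convexHull_insert (by simp), mem_convexJoin]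
  by_cases h : dt c a z + dt a b z = 0
  · refine ⟨a, rfl, b, subset_convexHull _ _ (by simp), ?_⟩
    have h2' : dt c a z = 0 := by linarith
    have h3' : dt a b z = 0 := by linarith
    have : z = a := by
      rw [h2', h3'] at e1 e2 hs
      ext
      · apply mul_left_cancel₀ hD.ne'; rw [e1, ← hs]; ring
      · apply mul_left_cancel₀ hD.ne'; rw [e2, ← hs]; ring
    rw [this]; exact left_mem_segment ℝ a b
  · have hp : 0 < dt c a z + dt a b z := lt_of_le_of_ne (by linarith) (Ne.symm h)
    set k := dt c a z + dt a b z with hk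
    refine ⟨a, rfl, (b.1 + dt a b z / k * (c.1 - b.1), b.2 + dt a b z / k * (c.2 - b.2)), ?_, ?_⟩
    · rw [convexHull_pair, seg_iff]
      exact ⟨dt a b z / k, by positivity, by rw [div_le_one hp]; linarith, rfl, rfl⟩
    · rw [seg_iff]
      refine ⟨k / dt a b c, by positivity, by rw [div_le_one hD]; linarith, ?_, ?_⟩
      · field_simp; rw [mul_comm, e1, ← hs]; rw [hk]; ring
      · field_simp; rw [mul_comm, e2, ← hs]; rw [hk]; ring

theorem quad_aux {K : Set (ℝ × ℝ)} (hK : IsPreconnected Kᶜ) (hb : Bornology.IsBounded K)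
    {a b c d : ℝ × ℝ} (h1 : 0 < dt a c b) (h2 : dt a c d < 0)
    (hab : Sees K a b) (hbc : Sees K b c) (hcd : Sees K c d) (hda : Sees K d a) : Sees K a c := by
  intro m hm
  by_contra hmK
  have h2' : 0 < dt c a d := by unfold dt at *; linarith
  let D : Set (ℝ × ℝ) := ({z | 0 < dt a c z} ∩ {z | 0 < dt c b z} ∩ {z | 0 < dt b a z}) ∪
    ({z | 0 < dt c a z} ∩ {z | 0 < dt a d z} ∩ {z | 0 < dt d c z}) ∪
    ({z | 0 < dt c b z} ∩ {z | 0 < dt b a z} ∩ {z | 0 < dt a d z} ∩ {z | 0 < dt d c z})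
  let S : Set (ℝ × ℝ) := ({z | 0 ≤ dt a c z} ∩ {z | 0 ≤ dt c b z} ∩ {z | 0 ≤ dt b a z}) ∪
    ({z | 0 ≤ dt c a z} ∩ {z | 0 ≤ dt a d z} ∩ {z | 0 ≤ dt d c z})
  have op : ∀ x y : ℝ × ℝ, IsOpen {z | 0 < dt x y z} := fun x y =>
    isOpen_lt continuous_const (dt_cont x y)
  have cl : ∀ x y : ℝ × ℝ, IsClosed {z | 0 ≤ dt x y z} := fun x y =>
    isClosed_le continuous_const (dt_cont x y)
  have hDo : IsOpen D := by
    refine IsOpen.union (IsOpen.union ?_ ?_) ?_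
    · exact ((op _ _).inter (op _ _)).inter (op _ _)
    · exact ((op _ _).inter (op _ _)).inter (op _ _)
    · exact (((op _ _).inter (op _ _)).inter (op _ _)).inter (op _ _)
  have hSc : IsClosed S := by
    refine IsClosed.union ?_ ?_
    · exact ((cl _ _).inter (cl _ _)).inter (cl _ _)
    · exact ((cl _ _).inter (cl _ _)).inter (cl _ _)
  have anti : ∀ z, dt c a z = - dt a c z := fun z => by unfold dt; ring
  have wk : ∀ x y z : ℝ × ℝ, z ∈ {z | 0 < dt x y z} → z ∈ {z | 0 ≤ dt x y z} := by
    intro x y z h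
    have h' : 0 < dt x y z := h
    exact h'.le
  have hDS : D ⊆ S := by
    rintro z ((⟨⟨x1, x2⟩, x3⟩ | ⟨⟨x1, x2⟩, x3⟩) | ⟨⟨⟨x1, x2⟩, x3⟩, x4⟩)
    · exact Or.inl ⟨⟨wk _ _ _ x1, wk _ _ _ x2⟩, wk _ _ _ x3⟩
    · exact Or.inr ⟨⟨wk _ _ _ x1, wk _ _ _ x2⟩, wk _ _ _ x3⟩
    · rcases le_total 0 (dt a c z) with h | h
      · exact Or.inl ⟨⟨h, wk _ _ _ x1⟩, wk _ _ _ x2⟩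
      · refine Or.inr ⟨⟨?_, wk _ _ _ x3⟩, wk _ _ _ x4⟩
        show 0 ≤ dt c a z
        rw [anti]; linarith
  -- points of S not in K lie in D
  have hcov : Kᶜ ⊆ D ∪ Sᶜ := by
    intro z hz
    by_cases hzS : z ∈ S
    swap
    · exact Or.inr hzS
    left
    rcases hzS with ⟨⟨x1, x2⟩, x3⟩ | ⟨⟨x1, x2⟩, x3⟩
    · simp only [Set.mem_ofPred_eq] at x1 x2 x3
      have y2 : 0 < dt c b z := by
        rcases x2.lt_or_eq with h | h
        · exact h
        · exact absurd (hbc.symm (seg_of_bary h1 h.symm x3 x1)) hz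
      have y3 : 0 < dt b a z := by
        rcases x3.lt_or_eq with h | h
        · exact h
        · have : 0 < dt c b a := by unfold dt at *; linarith
          exact absurd (hab.symm (seg_of_bary this h.symm x1 x2)) hz
      rcases x1.lt_or_eq with h | h
      · exact Or.inl (Or.inl ⟨⟨h, y2⟩, y3⟩)
      · right
        have e1 : dt a c b * dt a d z = dt b a z * (- dt a c d) + dt a c z * dt a d b := by
          unfold dt; ring
        have e2 : dt a c b * dt d c z = dt c b z * (- dt a c d) + dt a c z * dt d c b := by
          unfold dt; ring
        rw [← h] at e1 e2
        refine ⟨⟨⟨y2, y3⟩, ?_⟩, ?_⟩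
        · have : 0 < dt a c b * dt a d z := by rw [e1]; nlinarith
          exact pos_of_mul_pos_right this h1.le
        · have : 0 < dt a c b * dt d c z := by rw [e2]; nlinarith
          exact pos_of_mul_pos_right this h1.le
    · simp only [Set.mem_ofPred_eq] at x1 x2 x3
      have y2 : 0 < dt a d z := by
        rcases x2.lt_or_eq with h | h
        · exact h
        · exact absurd (hda.symm (seg_of_bary h2' h.symm x3 x1)) hz
      have y3 : 0 < dt d c z := by
        rcases x3.lt_or_eq with h | h
        · exact h
        · have : 0 < dt a d c := by unfold dt at *; linarith
          exact absurd (hcd.symm (seg_of_bary this h.symm x1 x2)) hz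
      rcases x1.lt_or_eq with h | h
      · exact Or.inl (Or.inr ⟨⟨h, y2⟩, y3⟩)
      · right
        have e1 : dt c a d * dt c b z = dt d c z * (dt a c b) + dt c a z * dt c b d := by
          unfold dt; ring
        have e2 : dt c a d * dt b a z = dt a d z * (dt a c b) + dt c a z * dt b a d := by
          unfold dt; ring
        rw [← h] at e1 e2
        refine ⟨⟨⟨?_, ?_⟩, y2⟩, y3⟩
        · have : 0 < dt c a d * dt c b z := by rw [e1]; nlinarith
          exact pos_of_mul_pos_right this h2'.le
        · have : 0 < dt c a d * dt b a z := by rw [e2]; nlinarith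
          exact pos_of_mul_pos_right this h2'.le
  have hSb : Bornology.IsBounded S := by
    have : S ⊆ convexHull ℝ ({a, c, b} : Set (ℝ × ℝ)) ∪ convexHull ℝ ({c, a, d} : Set (ℝ × ℝ)) := by
      rintro z (⟨⟨x1, x2⟩, x3⟩ | ⟨⟨x1, x2⟩, x3⟩)
      · exact Or.inl (hull_of_bary h1 x2 x3 x1)
      · exact Or.inr (hull_of_bary h2' x2 x3 x1)
    refine Bornology.IsBounded.subset (Bornology.IsBounded.union ?_ ?_) this
    · exact isBounded_convexHull.2 (Set.Finite.isBounded (by simp))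
    · exact isBounded_convexHull.2 (Set.Finite.isBounded (by simp))
  have hout : (Kᶜ ∩ Sᶜ).Nonempty := by
    rw [← Set.compl_union]
    rw [Set.nonempty_compl]
    intro h
    have := hb.union hSb
    rw [h] at this
    exact NormedSpace.unbounded_univ ℝ (ℝ × ℝ) this
  have hmD : (Kᶜ ∩ D).Nonempty := by
    refine ⟨m, hmK, ?_⟩
    rcases hcov hmK with h | h
    · exact h
    · exfalso
      apply h
      obtain ⟨θ, t0, t1, e1, e2⟩ := seg_iff.1 hm
      left
      have i1 : dt a c m = 0 := by unfold dt; rw [e1, e2]; ring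
      have i2 : dt c b m = (1 - θ) * dt a c b := by unfold dt; rw [e1, e2]; ring
      have i3 : dt b a m = θ * dt a c b := by unfold dt; rw [e1, e2]; ring
      refine ⟨⟨?_, ?_⟩, ?_⟩
      · exact i1.ge
      · show 0 ≤ dt c b m
        rw [i2]; exact mul_nonneg (by linarith) h1.le
      · show 0 ≤ dt b a m
        rw [i3]; exact mul_nonneg t0 h1.le
  obtain ⟨z, -, hz1, hz2⟩ := hK D Sᶜ hDo hSc.isOpen_compl hcov hmD hout
  exact hz2 (hDS hz1)

theorem quad_of_compl {K : Set (ℝ × ℝ)} (hK : IsPreconnected Kᶜ) (hb : Bornology.IsBounded K) :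
    Quad K := by
  intro a b c d h hab hbc hcd hda
  rcases mul_neg_iff.1 h with ⟨h1, h2⟩ | ⟨h1, h2⟩
  · exact quad_aux hK hb h1 h2 hab hbc hcd hda
  · exact quad_aux hK hb h2 h1 hda.symm hcd.symm hbc.symm hab.symm

/-- Triangle property. -/
theorem starTri {K : Set (ℝ × ℝ)} (hQ : Quad K) {g a b p : ℝ × ℝ} (ha : Sees K g a) (hb : Sees K g b)
    (hab : Sees K a b) (hp : p ∈ segment ℝ a b) : Sees K g p := by
  obtain ⟨θ, t0, t1, e1, e2⟩ := seg_iff.1 hp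
  rcases t0.eq_or_lt with h0 | h0
  · have : p = a := by ext <;> simp [e1, e2, ← h0]
    rwa [this]
  rcases t1.eq_or_lt with h1 | h1
  · have : p = b := by ext <;> simp [e1, e2, h1]
    rwa [this]
  by_cases hD : dt g a b = 0
  · by_cases hne : a = b
    · subst hne
      have : p = a := by ext <;> simp [e1, e2]
      rwa [this]
    -- collinear
    obtain ⟨γ, g1, g2⟩ : ∃ γ : ℝ, g.1 = a.1 + γ * (b.1 - a.1) ∧ g.2 = a.2 + γ * (b.2 - a.2) := by
      by_cases hx : b.1 - a.1 = 0
      · have hy : b.2 - a.2 ≠ 0 := by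
          intro hy; apply hne; ext <;> linarith
        refine ⟨(g.2 - a.2) / (b.2 - a.2), ?_, by field_simp; ring⟩
        have : (b.2 - a.2) * (g.1 - a.1) = 0 := by
          unfold dt at hD
          have : b.1 = a.1 := by linarith
          rw [this] at hD
          linarith
        rcases mul_eq_zero.1 this with h | h
        · exact absurd h hy
        · rw [hx]; linarith
      · refine ⟨(g.1 - a.1) / (b.1 - a.1), by field_simp; ring, ?_⟩
        have : (g.2 - a.2) * (b.1 - a.1) = (g.1 - a.1) * (b.2 - a.2) := by
          unfold dt at hD; linarith
        field_simp
        linarith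
    intro z hz
    obtain ⟨τ, s0, s1, z1, z2⟩ := seg_iff.1 hz
    set ζ := γ + τ * (θ - γ) with hζ
    have y1 : z.1 = a.1 + ζ * (b.1 - a.1) := by rw [z1, e1, g1, hζ]; ring
    have y2 : z.2 = a.2 + ζ * (b.2 - a.2) := by rw [z2, e2, g2, hζ]; ring
    by_cases c0 : ζ < 0
    · have hγ : γ ≤ ζ := by
        by_contra hc
        push Not at hc
        have h5 : τ * (θ - γ) < 0 := by linarith
        have h6 : θ < γ := by
          by_contra h7
          push Not at h7
          have := mul_nonneg s0 (sub_nonneg.2 h7)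
          linarith
        have := mul_nonneg (sub_nonneg.2 s1) (sub_nonneg.2 h6.le)
        nlinarith
      apply ha.symm
      rw [seg_iff]
      have hγ0 : γ < 0 := by linarith
      have hγ1 : γ ≠ 0 := hγ0.ne
      refine ⟨ζ / γ, div_nonneg_of_nonpos c0.le hγ0.le, (div_le_one_of_neg hγ0).2 hγ, ?_, ?_⟩
      · rw [y1, g1]; field_simp; ring
      · rw [y2, g2]; field_simp; ring
    · by_cases c1 : 1 < ζ
      · have hγ : ζ ≤ γ := by
          by_contra hc
          push Not at hc
          have h5 : 0 < τ * (θ - γ) := by linarith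
          have h6 : γ < θ := by
            by_contra h7
            push Not at h7
            have := mul_nonneg s0 (sub_nonneg.2 h7)
            linarith
          have := mul_nonneg (sub_nonneg.2 s1) (sub_nonneg.2 h6.le)
          nlinarith
        apply hb.symm
        rw [seg_iff]
        have hγ0 : 0 < γ - 1 := by linarith
        have hγ1 : γ - 1 ≠ 0 := hγ0.ne'
        refine ⟨(ζ - 1) / (γ - 1), div_nonneg (by linarith) hγ0.le,
          (div_le_one hγ0).2 (by linarith), ?_, ?_⟩
        · rw [y1, g1]; field_simp; ring
        · rw [y2, g2]; field_simp; ring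
      · exact hab (seg_iff.2 ⟨ζ, by linarith, by linarith, y1, y2⟩)
  · refine hQ g a p b ?_ ha (hab.sub (left_mem_segment _ _ _) hp)
      (hab.sub hp (right_mem_segment _ _ _)) hb.symm
    have i1 : dt g p a = - θ * dt g a b := by unfold dt; rw [e1, e2]; ring
    have i2 : dt g p b = (1 - θ) * dt g a b := by unfold dt; rw [e1, e2]; ring
    rw [i1, i2]
    have : 0 < (θ * (1 - θ)) * (dt g a b * dt g a b) :=
      mul_pos (mul_pos h0 (by linarith)) (mul_self_pos.2 hD)
    linarith


/-- point at height `y` on the line through `(s,0)` with inverse slope `m`. -/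
def pt (s m y : ℝ) : ℝ × ℝ := (s + m * y, y)

theorem pt_zero (s m : ℝ) : pt s m 0 = (s, 0) := by simp [pt]

theorem pt_eq {s m : ℝ} {z : ℝ × ℝ} (h : z.1 = s + m * z.2) : pt s m z.2 = z := by
  ext <;> simp [pt, h]

theorem pt_mem {s m y1 y2 y : ℝ} (h1 : y1 ≤ y) (h2 : y ≤ y2) :
    pt s m y ∈ segment ℝ (pt s m y1) (pt s m y2) := by
  rw [seg_iff]
  rcases (h1.trans h2).eq_or_lt with h | h
  · refine ⟨0, le_rfl, zero_le_one, ?_, ?_⟩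
    · have : y = y1 := by linarith
      simp [pt, this]
    · have : y = y1 := by linarith
      simp [pt, this]
  · have h' : 0 < y2 - y1 := by linarith
    refine ⟨(y - y1) / (y2 - y1), div_nonneg (by linarith) h'.le,
      (div_le_one h').2 (by linarith), ?_, ?_⟩
    · simp only [pt]; field_simp; ring
    · simp only [pt]; field_simp; ring

theorem mem_pt {s m y1 y2 : ℝ} {z : ℝ × ℝ} (h : y1 ≤ y2)
    (hz : z ∈ segment ℝ (pt s m y1) (pt s m y2)) : y1 ≤ z.2 ∧ z.2 ≤ y2 ∧ z = pt s m z.2 := by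
  obtain ⟨θ, t0, t1, e1, e2⟩ := seg_iff.1 hz
  simp only [pt] at e1 e2
  refine ⟨by nlinarith, by nlinarith, ?_⟩
  ext
  · simp only [pt]; rw [e1, e2]; ring
  · rfl

theorem sees_pt_sub {K : Set (ℝ × ℝ)} {s m y1 y2 a b : ℝ} (h : Sees K (pt s m y1) (pt s m y2))
    (a1 : y1 ≤ a) (a2 : a ≤ y2) (b1 : y1 ≤ b) (b2 : b ≤ y2) : Sees K (pt s m a) (pt s m b) :=
  h.sub (pt_mem a1 a2) (pt_mem b1 b2)

theorem sees_pt_join {K : Set (ℝ × ℝ)} {s m y1 y2 y3 : ℝ} (h12 : y1 ≤ y2) (h23 : y2 ≤ y3)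
    (h : Sees K (pt s m y1) (pt s m y2)) (h' : Sees K (pt s m y2) (pt s m y3)) :
    Sees K (pt s m y1) (pt s m y3) := by
  intro z hz
  obtain ⟨z1, z2, z3⟩ := mem_pt (h12.trans h23) hz
  rw [z3]
  rcases le_total z.2 y2 with h4 | h4
  · exact h (pt_mem z1 h4)
  · exact h' (pt_mem h4 z2)

theorem ax_mem {a b o : ℝ} (h1 : a ≤ o) (h2 : o ≤ b) :
    ((o, 0) : ℝ × ℝ) ∈ segment ℝ ((a, 0) : ℝ × ℝ) (b, 0) := by
  rw [seg_iff]
  rcases (h1.trans h2).eq_or_lt with h | h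
  · exact ⟨0, le_rfl, zero_le_one, by simp; linarith, by simp⟩
  · have h' : 0 < b - a := by linarith
    refine ⟨(o - a) / (b - a), div_nonneg (by linarith) h'.le,
      (div_le_one h').2 (by linarith), ?_, ?_⟩
    · simp only; field_simp; ring
    · simp

theorem mem_ax {a b : ℝ} {z : ℝ × ℝ} (h : a ≤ b)
    (hz : z ∈ segment ℝ ((a, 0) : ℝ × ℝ) (b, 0)) : a ≤ z.1 ∧ z.1 ≤ b ∧ z = (z.1, 0) := by
  obtain ⟨θ, t0, t1, e1, e2⟩ := seg_iff.1 hz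
  simp only at e1 e2
  refine ⟨by nlinarith, by nlinarith, ?_⟩
  ext
  · rfl
  · simp only; rw [e2]; ring

/-- A triangle with base on the axis. -/
def Tri (s m' t m : ℝ) : Set (ℝ × ℝ) := {z | 0 ≤ z.2 ∧ s + m' * z.2 ≤ z.1 ∧ z.1 ≤ t + m * z.2}

theorem mem_Tri {s m' t m : ℝ} {z : ℝ × ℝ} :
    z ∈ Tri s m' t m ↔ 0 ≤ z.2 ∧ s + m' * z.2 ≤ z.1 ∧ z.1 ≤ t + m * z.2 := Iff.rfl

theorem tri_seg {s m' t m : ℝ} {a b : ℝ × ℝ} (ha : a ∈ Tri s m' t m) (hb : b ∈ Tri s m' t m) :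
    segment ℝ a b ⊆ Tri s m' t m := by
  intro z hz
  obtain ⟨θ, t0, t1, e1, e2⟩ := seg_iff.1 hz
  obtain ⟨a1, a2, a3⟩ := ha
  obtain ⟨b1, b2, b3⟩ := hb
  refine ⟨?_, ?_, ?_⟩
  · rw [e2]; nlinarith
  · rw [e1, e2]; nlinarith
  · rw [e1, e2]; nlinarith

theorem tri_sub {K : Set (ℝ × ℝ)} (hQ : Quad K) {s m' t m h : ℝ} (hst : s < t)
    (hm : m < m') (hZ : s + m' * h = t + m * h) (hax : Sees K (s, 0) (t, 0))
    (h1 : Sees K (s, 0) (pt s m' h)) (h2 : Sees K (t, 0) (pt s m' h)) : Tri s m' t m ⊆ K := by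
  rintro z ⟨z0, z1, z2⟩
  have hzh : z.2 ≤ h := by nlinarith
  rcases hzh.eq_or_lt with e | e
  · have : z = pt s m' h := by
      ext
      · simp only [pt]; rw [e] at z1 z2; linarith
      · exact e
    rw [this]; exact h1.right
  · set n := (s + m' * h - z.1) / (h - z.2) with hn
    have hd : 0 < h - z.2 := by linarith
    have en : n * (h - z.2) = s + m' * h - z.1 := by rw [hn]; field_simp
    set o := z.1 - n * z.2 with ho
    have eo : pt o n h = pt s m' h := by
      ext
      · simp only [pt]; linarith
      · rfl
    have ez : pt o n z.2 = z := by
      ext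
      · simp only [pt]; linarith
      · rfl
    have hh : 0 < h := by linarith
    have o1 : s ≤ o := by
      have : m' ≥ n := by
        by_contra hc
        push Not at hc
        nlinarith
      nlinarith
    have o2 : o ≤ t := by
      have : m ≤ n := by
        by_contra hc
        push Not at hc
        nlinarith
      nlinarith
    have := starTri hQ h1.symm h2.symm hax (ax_mem o1 o2)
    rw [← eo, ← pt_zero o n] at this
    rw [← ez]
    exact this.symm (pt_mem z0 hzh)

theorem Sees.join {K : Set (ℝ × ℝ)} {a b c : ℝ × ℝ} (h1 : Sees K a b) (h2 : Sees K b c)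
    (hb : b ∈ segment ℝ a c) : Sees K a c := by
  intro z hz
  obtain ⟨θ, t0, t1, e1, e2⟩ := seg_iff.1 hb
  obtain ⟨τ, s0, s1, f1, f2⟩ := seg_iff.1 hz
  rcases le_total τ θ with h | h
  · apply h1
    rw [seg_iff]
    rcases t0.eq_or_lt with h0 | h0
    · have : τ = 0 := by linarith
      exact ⟨0, le_rfl, zero_le_one, by rw [f1, this]; ring, by rw [f2, this]; ring⟩
    · refine ⟨τ / θ, by positivity, (div_le_one h0).2 h, ?_, ?_⟩
      · rw [f1, e1]; field_simp; ring
      · rw [f2, e2]; field_simp; ring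
  · apply h2
    rw [seg_iff]
    rcases t1.eq_or_lt with h0 | h0
    · have : τ = 1 := by linarith
      refine ⟨0, le_rfl, zero_le_one, ?_, ?_⟩
      · rw [f1, e1, this, h0]; ring
      · rw [f2, e2, this, h0]; ring
    · have h0' : 0 < 1 - θ := by linarith
      refine ⟨(τ - θ) / (1 - θ), div_nonneg (by linarith) h0'.le,
        (div_le_one h0').2 (by linarith), ?_, ?_⟩
      · rw [f1, e1]; field_simp; ring
      · rw [f2, e2]; field_simp; ring

theorem sees_closed {K : Set (ℝ × ℝ)} (hK : IsClosed K) :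
    IsClosed {x : (ℝ × ℝ) × (ℝ × ℝ) | Sees K x.1 x.2} := by
  have : {x : (ℝ × ℝ) × (ℝ × ℝ) | Sees K x.1 x.2} =
      ⋂ θ ∈ Set.Icc (0:ℝ) 1, {x : (ℝ × ℝ) × (ℝ × ℝ) |
        (x.1.1 + θ * (x.2.1 - x.1.1), x.1.2 + θ * (x.2.2 - x.1.2)) ∈ K} := by
    ext x
    simp only [Set.mem_iInter, Set.mem_ofPred_eq]
    constructor
    · intro h θ hθ
      exact h (seg_iff.2 ⟨θ, hθ.1, hθ.2, rfl, rfl⟩)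
    · intro h z hz
      obtain ⟨θ, t0, t1, e1, e2⟩ := seg_iff.1 hz
      have := h θ ⟨t0, t1⟩
      rwa [← e1, ← e2] at this
  rw [this]
  refine isClosed_iInter fun θ => isClosed_iInter fun _ => hK.preimage ?_
  fun_prop

/-- axis property -/
def Ax (K : Set (ℝ × ℝ)) : Prop := ∀ a b : ℝ, (a, 0) ∈ K → (b, 0) ∈ K → Sees K (a, 0) (b, 0)

theorem lemA {K : Set (ℝ × ℝ)} (hQ : Quad K) (hax : Ax K) {g x p : ℝ × ℝ} {q t k : ℝ}
    (hgt : Sees K g (t, 0)) (hmin : ∀ o, Sees K g (o, 0) → t ≤ o) (hqt : q < t)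
    (hqx : Sees K (q, 0) x) (hxk : x.1 = q + k * x.2) (hpk : p.1 = q + k * p.2)
    (hp0 : 0 < p.2) (hpx : p.2 ≤ x.2) (hgx : Sees K g x) (hgp : ¬ Sees K g p) :
    g.2 ≠ 0 ∧ (g.1 - t) / g.2 < k ∧ Tri q k t ((g.1 - t) / g.2) ⊆ K ∧
      p.1 ≤ t + ((g.1 - t) / g.2) * p.2 := by
  have hx0 : 0 < x.2 := by linarith
  have hqK : (q, 0) ∈ K := hqx.left
  have htK : (t, 0) ∈ K := hgt.right
  have hnq : ¬ Sees K g (q, 0) := fun h => by have := hmin q h; linarith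
  have hg0 : g.2 ≠ 0 := by
    intro h
    apply hnq
    have : g = (g.1, 0) := by ext <;> simp [h]
    rw [this]
    exact hax _ _ (this ▸ hgt.left) hqK
  refine ⟨hg0, ?_⟩
  set m := (g.1 - t) / g.2 with hm
  have hgm : g.1 = t + m * g.2 := by rw [hm]; field_simp; ring
  have ex : pt q k x.2 = x := pt_eq hxk
  have ep : pt q k p.2 = p := pt_eq hpk
  have eg : pt t m g.2 = g := pt_eq hgm
  rcases lt_or_gt_of_ne hg0 with hneg | hpos
  · -- guard below the axis
    set n := (x.1 - g.1) / (x.2 - g.2) with hn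
    have hd : 0 < x.2 - g.2 := by linarith
    have en : n * (x.2 - g.2) = x.1 - g.1 := by rw [hn]; field_simp
    set c := x.1 - n * x.2 with hc
    have ecx : pt c n x.2 = x := pt_eq (by linarith)
    have ecg : pt c n g.2 = g := pt_eq (by linarith)
    have hgx' : Sees K (pt c n g.2) (pt c n x.2) := by rw [ecx, ecg]; exact hgx
    have hgc : Sees K g (c, 0) := by
      have := sees_pt_sub hgx' le_rfl (by linarith) hneg.le hx0.le
      rwa [ecg, pt_zero] at this
    have htc : t ≤ c := hmin c hgc
    have hcx : Sees K (c, 0) x := by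
      have := sees_pt_sub hgx' hneg.le hx0.le (by linarith) le_rfl
      rwa [ecx, pt_zero] at this
    have hnk : n < k := by
      by_contra h
      push Not at h
      nlinarith
    have hmn : m ≤ n := by
      by_contra h
      push Not at h
      nlinarith
    have hT : Tri q k c n ⊆ K := by
      refine tri_sub hQ (h := x.2) (by linarith) hnk (by linarith) (hax _ _ hqK hgc.right) ?_ ?_
      · rwa [ex]
      · rwa [ex]
    refine ⟨by linarith, ?_, ?_⟩
    · rintro z ⟨z0, z1, z2⟩
      apply hT
      exact ⟨z0, z1, by nlinarith⟩
    · by_contra hcon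
      push Not at hcon
      apply hgp
      have hd' : 0 < p.2 - g.2 := by linarith
      set n' := (p.1 - g.1) / (p.2 - g.2) with hn'
      have en' : n' * (p.2 - g.2) = p.1 - g.1 := by rw [hn']; field_simp
      set o := p.1 - n' * p.2 with ho
      have eop : pt o n' p.2 = p := pt_eq (by linarith)
      have eog : pt o n' g.2 = g := pt_eq (by linarith)
      have hpc : p.1 ≤ c + n * p.2 := by nlinarith
      have i1 : m < n' := by
        by_contra h
        push Not at h
        nlinarith
      have i2 : n' ≤ n := by
        by_contra h
        push Not at h
        nlinarith
      have o1 : t ≤ o := by nlinarith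
      have o2 : o ≤ c := by nlinarith
      have s1 : Sees K g (o, 0) := starTri hQ hgt hgc (hax _ _ htK hgc.right) (ax_mem o1 o2)
      have s2 : Sees K (o, 0) p := by
        refine (tri_seg ?_ ?_).trans hT
        · refine ⟨le_rfl, ?_, ?_⟩ <;> simp <;> linarith
        · exact ⟨hp0.le, hpk.ge, hpc⟩
      refine s1.join s2 ?_
      have := pt_mem (s := o) (m := n') hneg.le hp0.le
      rwa [eop, eog, pt_zero] at this
  · rcases le_or_gt (q + k * g.2) g.1 with hle | hlt
    · exfalso
      apply hnq
      rcases hle.eq_or_lt with he | hl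
      · have eg' : pt q k g.2 = g := pt_eq he.symm
        rcases le_total g.2 x.2 with h | h
        · rw [← ex, ← pt_zero q k] at hqx
          have := sees_pt_sub hqx hpos.le h le_rfl hx0.le
          rwa [eg', pt_zero] at this
        · rw [← ex, ← pt_zero q k] at hqx
          rw [← ex, ← eg'] at hgx
          have := sees_pt_join hx0.le h hqx hgx.symm
          rw [eg', pt_zero] at this
          exact this.symm
      · refine (hQ (q, 0) x g (t, 0) ?_ hqx hgx.symm hgt (hax _ _ htK hqK)).symm
        have i1 : dt (q, 0) g x = (g.1 - (q + k * g.2)) * x.2 := by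
          unfold dt; simp only; rw [hxk]; ring
        have i2 : dt (q, 0) g (t, 0) = - (g.2 * (t - q)) := by
          unfold dt; simp only; ring
        rw [i1, i2]
        have := mul_pos (mul_pos (sub_pos.2 hl) hx0) (mul_pos hpos (sub_pos.2 hqt))
        linarith
    · have hmk : m < k := by
        by_contra h
        push Not at h
        nlinarith
      have hkm : 0 < k - m := by linarith
      set η := (t - q) / (k - m) with hη
      have eη : η * (k - m) = t - q := by rw [hη]; field_simp
      have η0 : 0 < η := div_pos (by linarith) hkm
      have ηg : η < g.2 := by
        by_contra h
        push Not at h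
        nlinarith
      have eY : pt q k η = pt t m η := by
        ext
        · simp only [pt]; linarith
        · rfl
      have hgt' : Sees K (pt t m 0) (pt t m g.2) := by rw [pt_zero, eg]; exact hgt.symm
      have htY : Sees K (t, 0) (pt q k η) := by
        have := sees_pt_sub hgt' le_rfl hpos.le η0.le ηg.le
        rwa [pt_zero, ← eY] at this
      have hgY : Sees K g (pt q k η) := by
        have := sees_pt_sub hgt' hpos.le le_rfl η0.le ηg.le
        rwa [eg, ← eY] at this
      have hqx' : Sees K (pt q k 0) (pt q k x.2) := by rw [pt_zero, ex]; exact hqx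
      have key : Sees K (q, 0) (pt q k η) ∧ p.2 ≤ η := by
        rcases le_or_gt η x.2 with h | h
        · refine ⟨?_, ?_⟩
          · have := sees_pt_sub hqx' le_rfl hx0.le η0.le h
            rwa [pt_zero] at this
          · by_contra hc
            push Not at hc
            apply hgp
            refine starTri hQ hgY hgx ?_ (p := p) ?_
            · have := sees_pt_sub hqx' η0.le h hx0.le le_rfl
              rwa [ex] at this
            · have := pt_mem (s := q) (m := k) hc.le hpx
              rwa [ex, ep] at this
        · refine ⟨?_, by linarith⟩
          have hxt : Sees K x (t, 0) := by
            refine hQ x (q, 0) (t, 0) g ?_ hqx.symm (hax _ _ hqK htK) hgt.symm hgx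
            have i1 : dt x (t, 0) (q, 0) = - (x.2 * (t - q)) := by
              unfold dt; simp only; ring
            have i2 : dt x (t, 0) g = g.2 * ((η - x.2) * (k - m)) := by
              have : (η - x.2) * (k - m) = t - q - x.2 * (k - m) := by rw [← eη]; ring
              rw [this]
              unfold dt; simp only; rw [hgm, hxk]; ring
            rw [i1, i2]
            have := mul_pos (mul_pos hpos (mul_pos (sub_pos.2 h) hkm))
              (mul_pos hx0 (sub_pos.2 hqt))
            linarith
          have hYseg : pt q k η ∈ segment ℝ ((t, 0) : ℝ × ℝ) g := by
            have := pt_mem (s := t) (m := m) η0.le ηg.le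
            rwa [eg, pt_zero, ← eY] at this
          have := starTri hQ hxt hgx.symm hgt.symm hYseg
          rw [← ex] at this
          have := sees_pt_join hx0.le h.le hqx' this
          rwa [pt_zero] at this
      refine ⟨hmk, ?_, ?_⟩
      · refine tri_sub hQ (h := η) hqt hmk (by linarith) (hax _ _ hqK htK) key.1 htY
      · have := key.2
        nlinarith


/-- mirror image -/
def mir (z : ℝ × ℝ) : ℝ × ℝ := (-z.1, z.2)

theorem mir_mir (z : ℝ × ℝ) : mir (mir z) = z := by simp [mir]

theorem mir_seg {a b z : ℝ × ℝ} (h : z ∈ segment ℝ a b) : mir z ∈ segment ℝ (mir a) (mir b) := by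
  obtain ⟨θ, t0, t1, e1, e2⟩ := seg_iff.1 h
  refine seg_iff.2 ⟨θ, t0, t1, ?_, ?_⟩
  · simp only [mir]; rw [e1]; ring
  · simp only [mir]; rw [e2]

theorem mir_sees {K : Set (ℝ × ℝ)} {a b : ℝ × ℝ} : Sees (mir ⁻¹' K) a b ↔ Sees K (mir a) (mir b) := by
  constructor
  · intro h z hz
    have := h (mir_seg hz |> fun h => by rwa [mir_mir, mir_mir] at h)
    rwa [Set.mem_preimage, mir_mir] at this
  · intro h z hz
    exact h (mir_seg hz)

theorem mir_quad {K : Set (ℝ × ℝ)} (hQ : Quad K) : Quad (mir ⁻¹' K) := by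
  intro a b c d h h1 h2 h3 h4
  rw [mir_sees] at *
  refine hQ _ _ _ _ ?_ h1 h2 h3 h4
  have : ∀ x y z, dt (mir x) (mir y) (mir z) = - dt x y z := by
    intro x y z; unfold dt mir; simp only; ring
  rw [this, this]
  linarith

theorem mir_ax {K : Set (ℝ × ℝ)} (h : Ax K) : Ax (mir ⁻¹' K) := by
  intro a b ha hb
  rw [mir_sees]
  exact h _ _ ha hb

theorem lemB {K : Set (ℝ × ℝ)} (hQ : Quad K) (hax : Ax K) {g x p : ℝ × ℝ} {q t k : ℝ}
    (hgt : Sees K g (t, 0)) (hmax : ∀ o, Sees K g (o, 0) → o ≤ t) (hqt : t < q)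
    (hqx : Sees K (q, 0) x) (hxk : x.1 = q + k * x.2) (hpk : p.1 = q + k * p.2)
    (hp0 : 0 < p.2) (hpx : p.2 ≤ x.2) (hgx : Sees K g x) (hgp : ¬ Sees K g p) :
    g.2 ≠ 0 ∧ k < (g.1 - t) / g.2 ∧ Tri t ((g.1 - t) / g.2) q k ⊆ K ∧
      t + ((g.1 - t) / g.2) * p.2 ≤ p.1 := by
  have hm : ∀ a b, Sees (mir ⁻¹' K) (mir a) (mir b) ↔ Sees K a b := by
    intro a b; rw [mir_sees, mir_mir, mir_mir]
  have hma : ∀ a b, Sees (mir ⁻¹' K) (mir a) (-b, 0) ↔ Sees K a (b, 0) := by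
    intro a b; exact hm a (b, 0)
  have h := lemA (K := mir ⁻¹' K) (mir_quad hQ) (mir_ax hax) (g := mir g) (x := mir x) (p := mir p)
    (q := -q) (t := -t) (k := -k) ((hma _ _).2 hgt)
    (fun o ho => by
      have := hmax (-o) ((hma _ _).1 (by simpa using ho))
      linarith) (by linarith) ((hm (q, 0) x).2 hqx) (by simp only [mir]; linarith)
    (by simp only [mir]; linarith) hp0 hpx ((hm _ _).2 hgx) (by rwa [hm])
  have e : ((mir g).1 - -t) / (mir g).2 = - ((g.1 - t) / g.2) := by
    simp only [mir]; ring
  rw [e] at h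
  obtain ⟨h1, h2, h3, h4⟩ := h
  refine ⟨h1, by linarith, ?_, ?_⟩
  · rintro z ⟨z0, z1, z2⟩
    have : mir z ∈ mir ⁻¹' K := by
      apply h3
      refine ⟨z0, ?_, ?_⟩
      · simp only [mir]; linarith
      · simp only [mir]; linarith
    rwa [Set.mem_preimage, mir_mir] at this
  · simp only [mir] at h4; linarith

/-- left end of window -/
noncomputable def lo (K : Set (ℝ × ℝ)) (g : ℝ × ℝ) : ℝ := sInf {o : ℝ | Sees K g (o, 0)}
/-- right end of window -/
noncomputable def hi (K : Set (ℝ × ℝ)) (g : ℝ × ℝ) : ℝ := sSup {o : ℝ | Sees K g (o, 0)}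

theorem win {K : Set (ℝ × ℝ)} (hc : IsCompact K) (hQ : Quad K) (hax : Ax K) {g : ℝ × ℝ}
    (hg : ∃ o : ℝ, Sees K g (o, 0)) :
    lo K g ≤ hi K g ∧ ∀ o : ℝ, Sees K g (o, 0) ↔ lo K g ≤ o ∧ o ≤ hi K g := by
  set W := {o : ℝ | Sees K g (o, 0)} with hW
  have hcl : IsClosed W :=
    (sees_closed hc.isClosed).preimage (f := fun o : ℝ => (g, ((o, 0) : ℝ × ℝ))) (by fun_prop)
  have hWc : IsCompact W := by
    refine (hc.image continuous_fst).of_isClosed_subset hcl ?_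
    intro o ho
    exact ⟨(o, 0), Sees.right ho, rfl⟩
  have hne : W.Nonempty := hg
  have h1 : lo K g ∈ W := hWc.sInf_mem hne
  have h2 : hi K g ∈ W := hWc.sSup_mem hne
  refine ⟨csInf_le hWc.bddBelow h2, fun o => ⟨fun h => ⟨csInf_le hWc.bddBelow h, le_csSup hWc.bddAbove h⟩, ?_⟩⟩
  rintro ⟨a, b⟩
  exact starTri hQ h1 h2 (hax _ _ (Sees.right h1) (Sees.right h2)) (ax_mem a b)

theorem exists_exit {K : Set (ℝ × ℝ)} (hc : IsCompact K) {p : ℝ × ℝ} {q k : ℝ} (hp : 0 < p.2)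
    (hpk : p.1 = q + k * p.2) (hs : Sees K p (q, 0)) :
    ∃ h, p.2 ≤ h ∧ pt q k h ∈ frontier K ∧ Sees K (q, 0) (pt q k h) := by
  set S := {h : ℝ | p.2 ≤ h ∧ Sees K (q, 0) (pt q k h)} with hS
  have hcl : IsClosed S := by
    refine IsClosed.inter isClosed_Ici ?_
    exact (sees_closed hc.isClosed).preimage (f := fun h : ℝ => (((q, 0) : ℝ × ℝ), pt q k h))
      (by unfold pt; fun_prop)
  have hSc : IsCompact S := by
    refine (hc.image continuous_snd).of_isClosed_subset hcl ?_
    intro o ho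
    exact ⟨pt q k o, ho.2.right, rfl⟩
  have hne : S.Nonempty := ⟨p.2, le_rfl, by rw [pt_eq hpk]; exact hs.symm⟩
  have hm := hSc.sSup_mem hne
  set H := sSup S with hH
  refine ⟨H, hm.1, ?_, hm.2⟩
  rw [hc.isClosed.frontier_eq]
  refine ⟨hm.2.right, fun hintr => ?_⟩
  have hcont : Continuous (fun h => pt q k h) := by unfold pt; fun_prop
  have := hcont.continuousAt.preimage_mem_nhds (isOpen_interior.mem_nhds hintr)
  obtain ⟨ε, ε0, hε⟩ := Metric.mem_nhds_iff.1 this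
  have : H + ε / 2 ∈ S := by
    refine ⟨by have := hm.1; linarith, ?_⟩
    have h1 := hm.2
    rw [← pt_zero q k] at h1 ⊢
    have hm1 := hm.1
    refine sees_pt_join (by linarith) (by linarith) h1 ?_
    intro z hz
    obtain ⟨z1, z2, z3⟩ := mem_pt (by linarith) hz
    rw [z3]
    apply interior_subset
    apply hε
    rw [Metric.mem_ball, Real.dist_eq, abs_lt]
    constructor <;> linarith
  have := le_csSup hSc.bddAbove this
  linarith

/-- left side slope -/
noncomputable def ml (K : Set (ℝ × ℝ)) (g : ℝ × ℝ) : ℝ := (g.1 - lo K g) / g.2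
/-- right side slope -/
noncomputable def mr (K : Set (ℝ × ℝ)) (g : ℝ × ℝ) : ℝ := (g.1 - hi K g) / g.2

/-- triangle spanned by a pair of guards -/
def TT (K : Set (ℝ × ℝ)) (a c : ℝ × ℝ) : Set (ℝ × ℝ) := Tri (hi K a) (mr K a) (lo K c) (ml K c)

/-- a pair of guards spans a triangle in `K`. -/
structure Valid (K : Set (ℝ × ℝ)) (a c : ℝ × ℝ) : Prop where
  a0 : a.2 ≠ 0
  c0 : c.2 ≠ 0
  base : hi K a < lo K c
  slope : ml K c < mr K a
  sub : TT K a c ⊆ K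

theorem exists_pair {K : Set (ℝ × ℝ)} (hc : IsCompact K) (hQ : Quad K) (hax : Ax K)
    (hwv : ∀ p ∈ K, ∃ o : ℝ, Sees K p (o, 0)) (G : Finset (ℝ × ℝ))
    (hguard : ∀ x ∈ frontier K, ∃ g ∈ G, Sees K g x) {p : ℝ × ℝ} (hpK : p ∈ K) (hp : 0 < p.2)
    (hun : ∀ g ∈ G, ¬ Sees K g p) : ∃ a ∈ G, ∃ c ∈ G, Valid K a c ∧ p ∈ TT K a c := by
  obtain ⟨hαβ, hW⟩ := win hc hQ hax (hwv p hpK)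
  set α := lo K p
  set β := hi K p
  let A : ℝ × ℝ → Set ℝ := fun g => {q | ∃ x ∈ K, (x.1 - q) * p.2 = (p.1 - q) * x.2 ∧ p.2 ≤ x.2 ∧
    Sees K (q, 0) x ∧ Sees K g x} ∩ Set.Icc α β
  have hAcl : ∀ g, IsClosed (A g) := by
    intro g
    let B : Set ((ℝ × ℝ) × ℝ) := {y | (y.1.1 - y.2) * p.2 = (p.1 - y.2) * y.1.2} ∩
      {y | p.2 ≤ y.1.2} ∩ {y | Sees K (y.2, 0) y.1} ∩ {y | Sees K g y.1} ∩ K ×ˢ Set.Icc α β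
    have hBc : IsCompact B := by
      refine (hc.prod isCompact_Icc).of_isClosed_subset ?_ Set.inter_subset_right
      refine IsClosed.inter (IsClosed.inter (IsClosed.inter (IsClosed.inter ?_ ?_) ?_) ?_) ?_
      · exact isClosed_eq (by fun_prop) (by fun_prop)
      · exact isClosed_le (by fun_prop) (by fun_prop)
      · exact (sees_closed hc.isClosed).preimage
          (f := fun y : (ℝ × ℝ) × ℝ => (((y.2, 0) : ℝ × ℝ), y.1)) (by fun_prop)
      · exact (sees_closed hc.isClosed).preimage
          (f := fun y : (ℝ × ℝ) × ℝ => (g, y.1)) (by fun_prop)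
      · exact hc.isClosed.prod isClosed_Icc
    have : A g = Prod.snd '' B := by
      ext q
      constructor
      · rintro ⟨⟨x, xK, x1, x2, x3, x4⟩, hq⟩
        exact ⟨(x, q), ⟨⟨⟨⟨x1, x2⟩, x3⟩, x4⟩, ⟨xK, hq⟩⟩, rfl⟩
      · rintro ⟨⟨x, q'⟩, ⟨⟨⟨⟨x1, x2⟩, x3⟩, x4⟩, ⟨xK, hq⟩⟩, rfl⟩
        exact ⟨⟨x, xK, x1, x2, x3, x4⟩, hq⟩
    rw [this]
    exact (hBc.image continuous_snd).isClosed
  have hGw : ∀ g, (∃ x, Sees K g x) → lo K g ≤ hi K g ∧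
      ∀ o : ℝ, Sees K g (o, 0) ↔ lo K g ≤ o ∧ o ≤ hi K g := by
    rintro g ⟨x, hx⟩
    exact win hc hQ hax (hwv g hx.left)
  -- not in window
  have hnw : ∀ g ∈ G, ∀ q ∈ A g, ¬ Sees K g (q, 0) := by
    rintro g hg q ⟨⟨x, xK, x1, x2, x3, x4⟩, hq⟩ hs
    apply hun g hg
    refine starTri hQ hs x4 x3 ?_
    have e1 : pt q ((p.1 - q) / p.2) p.2 = p := pt_eq (by field_simp; ring)
    have e2 : pt q ((p.1 - q) / p.2) x.2 = x := pt_eq (by field_simp; linarith)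
    have := pt_mem (s := q) (m := (p.1 - q) / p.2) hp.le x2
    rwa [e1, e2, pt_zero] at this
  have hA : ∀ g ∈ G, ∀ q ∈ A g, q ≤ lo K g → q < lo K g ∧ g.2 ≠ 0 ∧ ml K g < (p.1 - q) / p.2 ∧
      Tri q ((p.1 - q) / p.2) (lo K g) (ml K g) ⊆ K ∧ p.1 ≤ lo K g + ml K g * p.2 := by
    intro g hg q hq hle
    have hn := hnw g hg q hq
    obtain ⟨⟨x, xK, x1, x2, x3, x4⟩, hq⟩ := hq
    obtain ⟨w1, w2⟩ := hGw g ⟨x, x4⟩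
    have hlt : q < lo K g := by
      rcases hle.eq_or_lt with h | h
      · exact absurd ((w2 q).2 ⟨h.ge, by linarith⟩) hn
      · exact h
    exact ⟨hlt, lemA hQ hax ((w2 _).2 ⟨le_rfl, w1⟩) (fun o ho => ((w2 o).1 ho).1) hlt x3
      (by field_simp; linarith) (by field_simp; ring) hp x2 x4 (hun g hg)⟩
  have hB : ∀ g ∈ G, ∀ q ∈ A g, hi K g ≤ q → hi K g < q ∧ g.2 ≠ 0 ∧ (p.1 - q) / p.2 < mr K g ∧
      Tri (hi K g) (mr K g) q ((p.1 - q) / p.2) ⊆ K ∧ hi K g + mr K g * p.2 ≤ p.1 := by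
    intro g hg q hq hle
    have hn := hnw g hg q hq
    obtain ⟨⟨x, xK, x1, x2, x3, x4⟩, hq⟩ := hq
    obtain ⟨w1, w2⟩ := hGw g ⟨x, x4⟩
    have hlt : hi K g < q := by
      rcases hle.eq_or_lt with h | h
      · exact absurd ((w2 q).2 ⟨by linarith, h.ge⟩) hn
      · exact h
    exact ⟨hlt, lemB hQ hax ((w2 _).2 ⟨w1, le_rfl⟩) (fun o ho => ((w2 o).1 ho).2) hlt x3
      (by field_simp; linarith) (by field_simp; ring) hp x2 x4 (hun g hg)⟩
  let SA : Set ℝ := ⋃ g ∈ G, A g ∩ {q | q ≤ lo K g}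
  let SB : Set ℝ := ⋃ g ∈ G, A g ∩ {q | hi K g ≤ q}
  have hSA : IsClosed SA := isClosed_biUnion_finset fun g _ => (hAcl g).inter isClosed_Iic
  have hSB : IsClosed SB := isClosed_biUnion_finset fun g _ => (hAcl g).inter isClosed_Ici
  have hcov : Set.Icc α β ⊆ SA ∪ SB := by
    intro q hq
    have hs : Sees K p (q, 0) := (hW q).2 hq
    obtain ⟨h, h1, h2, h3⟩ := exists_exit hc (q := q) (k := (p.1 - q) / p.2) hp
      (by field_simp; ring) hs
    obtain ⟨g, hg, hgx⟩ := hguard _ h2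
    have hqA : q ∈ A g := by
      refine ⟨⟨_, h3.right, ?_, h1, h3, hgx⟩, hq⟩
      simp only [pt]; field_simp; ring
    have hn := hnw g hg q hqA
    obtain ⟨w1, w2⟩ := hGw g ⟨_, hgx⟩
    rw [w2] at hn
    rcases le_or_gt q (lo K g) with h | h
    · left
      exact Set.mem_iUnion₂.2 ⟨g, hg, hqA, h⟩
    · right
      refine Set.mem_iUnion₂.2 ⟨g, hg, hqA, ?_⟩
      by_contra hc
      exact hn ⟨h.le, (not_le.1 hc).le⟩
  have hα : α ∉ SB := by
    intro h
    obtain ⟨g, hg, hq, hle⟩ := Set.mem_iUnion₂.1 h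
    obtain ⟨b1, b2, b3, b4, b5⟩ := hB g hg α hq hle
    have : Sees K p (hi K g, 0) := by
      refine (tri_seg ?_ ?_).trans b4
      · exact ⟨hp.le, b5, by field_simp; linarith⟩
      · refine ⟨le_rfl, ?_, ?_⟩ <;> simp
        exact b1.le
    have := ((hW _).1 this).1
    linarith
  have hβ : β ∉ SA := by
    intro h
    obtain ⟨g, hg, hq, hle⟩ := Set.mem_iUnion₂.1 h
    obtain ⟨b1, b2, b3, b4, b5⟩ := hA g hg β hq hle
    have : Sees K p (lo K g, 0) := by
      refine (tri_seg ?_ ?_).trans b4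
      · exact ⟨hp.le, by field_simp; linarith, b5⟩
      · refine ⟨le_rfl, ?_, ?_⟩ <;> simp
        exact b1.le
    have := ((hW _).1 this).2
    linarith
  have hαI : α ∈ Set.Icc α β := ⟨le_rfl, hαβ⟩
  have hβI : β ∈ Set.Icc α β := ⟨hαβ, le_rfl⟩
  obtain ⟨q, hq, hqA, hqB⟩ := isPreconnected_closed_iff.1 (isPreconnected_Icc (a := α) (b := β))
    SA SB hSA hSB hcov ⟨α, hαI, (hcov hαI).resolve_right hα⟩ ⟨β, hβI, (hcov hβI).resolve_left hβ⟩
  obtain ⟨c, hcG, hcq, hcle⟩ := Set.mem_iUnion₂.1 hqA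
  obtain ⟨a, haG, haq, hale⟩ := Set.mem_iUnion₂.1 hqB
  obtain ⟨c1, c2, c3, c4, c5⟩ := hA c hcG q hcq hcle
  obtain ⟨a1, a2, a3, a4, a5⟩ := hB a haG q haq hale
  refine ⟨a, haG, c, hcG, ⟨a2, c2, by linarith, by linarith, ?_⟩, ⟨hp.le, a5, c5⟩⟩
  rintro z ⟨z0, z1, z2⟩
  rcases le_total z.1 (q + (p.1 - q) / p.2 * z.2) with h | h
  · exact a4 ⟨z0, z1, h⟩
  · exact c4 ⟨z0, h, z2⟩


theorem tri_int {K : Set (ℝ × ℝ)} {s m' t m : ℝ} (h : Tri s m' t m ⊆ K) {z : ℝ × ℝ}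
    (h0 : 0 < z.2) (h1 : s + m' * z.2 < z.1) (h2 : z.1 < t + m * z.2) : z ∈ interior K := by
  have o1 : IsOpen {z : ℝ × ℝ | 0 < z.2} := isOpen_lt (by fun_prop) (by fun_prop)
  have o2 : IsOpen {z : ℝ × ℝ | s + m' * z.2 < z.1} := isOpen_lt (by fun_prop) (by fun_prop)
  have o3 : IsOpen {z : ℝ × ℝ | z.1 < t + m * z.2} := isOpen_lt (by fun_prop) (by fun_prop)
  refine interior_maximal ?_ ((o1.inter o2).inter o3) ⟨⟨h0, h1⟩, h2⟩
  rintro y ⟨⟨y0, y1⟩, y2⟩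
  have y0' : 0 < y.2 := y0
  have y1' : s + m' * y.2 < y.1 := y1
  have y2' : y.1 < t + m * y.2 := y2
  exact h ⟨y0'.le, y1'.le, y2'.le⟩

set_option maxHeartbeats 1000000 in
theorem nest {K : Set (ℝ × ℝ)} (hc : IsCompact K) (hQ : Quad K) (hax : Ax K)
    (hwv : ∀ p ∈ K, ∃ o : ℝ, Sees K p (o, 0)) {a1 a c p : ℝ × ℝ} (V1 : Valid K a1 c)
    (V2 : Valid K a c) (haf : a ∈ frontier K) (hp : 0 < p.2) (hp1 : p ∈ TT K a1 c)
    (hap : ¬ Sees K a p) (hlt : hi K a1 < hi K a) (hp2 : p ∉ TT K a c)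
    (hmin : Valid K a1 a → p ∈ TT K a1 a → lo K c - hi K a1 ≤ lo K a - hi K a1) :
    TT K a c ⊆ TT K a1 c := by
  rintro z ⟨z0, z1, z2⟩
  refine ⟨z0, ?_, z2⟩
  by_contra hz
  push Not at hz
  have haK : a ∈ K := hc.isClosed.frontier_subset haf
  obtain ⟨w1, w2⟩ := win hc hQ hax (hwv a haK)
  have hsub1 := V1.sub
  have hb1 := V1.base
  have hb2 := V2.base
  have ha0 := V2.a0
  have e1 : a.1 = hi K a + mr K a * a.2 := by unfold mr; field_simp; ring
  have e2 : a.1 = lo K a + ml K a * a.2 := by unfold ml; field_simp; ring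
  have hvalid : ∀ (h1 : hi K a1 < lo K a) (h2 : ml K a < mr K a1) (h3 : TT K a1 a ⊆ K),
    Valid K a1 a := fun h1 h2 h3 => ⟨V1.a0, ha0, h1, h2, h3⟩
  unfold TT at *
  set s1 := hi K a1
  set m1 := mr K a1
  set s2 := hi K a
  set m2 := mr K a
  set t := lo K c
  set mm := ml K c
  set l := lo K a
  set ma := ml K a
  obtain ⟨p0, q1, q2⟩ := hp1
  have hz0 : 0 < z.2 := by
    rcases z0.eq_or_lt with h | h
    · rw [← h] at hz z1; linarith
    · exact h
  have hm12 : m2 < m1 := by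
    by_contra h
    push Not at h
    nlinarith
  have hpe : p.1 < s2 + m2 * p.2 := by
    by_contra h
    push Not at h
    exact hp2 ⟨p0, h, q2⟩
  have hd : 0 < m1 - m2 := by linarith
  obtain ⟨e, he⟩ : ∃ e, e * (m1 - m2) = s2 - s1 := ⟨(s2 - s1) / (m1 - m2), by field_simp⟩
  have hez : e < z.2 := by
    by_contra h
    push Not at h
    nlinarith
  have hpe' : p.2 < e := by
    by_contra h
    push Not at h
    nlinarith
  -- right side inside for heights below z
  have hin : ∀ y, 0 ≤ y → y < z.2 → s2 + m2 * y < t + mm * y := by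
    intro y y0 y1
    have : z.2 * (s2 + m2 * y) < z.2 * (t + mm * y) := by nlinarith
    exact lt_of_mul_lt_mul_left this hz0.le
  have hae : 0 < a.2 → e ≤ a.2 := by
    intro hpos
    by_contra h
    push Not at h
    have hintr : a ∈ interior K := by
      refine tri_int hsub1 hpos ?_ ?_
      · nlinarith
      · rw [e1]; exact hin _ hpos.le (by linarith)
    rw [hc.isClosed.frontier_eq] at haf
    exact haf.2 hintr
  have hla : ∀ o : ℝ, l ≤ o → o ≤ s2 → Sees K a (o, 0) := fun o h1 h2 => (w2 o).2 ⟨h1, h2⟩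
  rcases le_or_gt (l + ma * p.2) p.1 with hcase | hcase
  · apply hap
    have hdd : a.2 - p.2 ≠ 0 := by
      intro h
      rcases lt_or_gt_of_ne ha0 with h' | h'
      · linarith
      · have := hae h'; linarith
    obtain ⟨n, hn⟩ : ∃ n, n * (a.2 - p.2) = a.1 - p.1 :=
      ⟨(a.1 - p.1) / (a.2 - p.2), by field_simp⟩
    obtain ⟨o, ho⟩ : ∃ o, o = p.1 - n * p.2 := ⟨_, rfl⟩
    have eop : pt o n p.2 = p := pt_eq (by linarith)
    have eoa : pt o n a.2 = a := pt_eq (by linarith)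
    rcases lt_or_gt_of_ne ha0 with hneg | hpos
    · have i1 : n < m2 := by
        by_contra h
        push Not at h
        nlinarith
      have i2 : ma ≤ n := by
        by_contra h
        push Not at h
        nlinarith
      have o2 : o ≤ s2 := by nlinarith
      have o1 : l ≤ o := by nlinarith
      have o3 : s1 ≤ o := by
        by_contra h
        push Not at h
        nlinarith
      refine (hla o o1 o2).join (b := (o, 0)) ?_ ?_
      · refine (tri_seg ?_ ?_).trans hsub1
        · refine ⟨le_rfl, ?_, ?_⟩ <;> simp <;> linarith
        · exact ⟨p0, q1, q2⟩
      · have := pt_mem (s := o) (m := n) hneg.le p0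
        rwa [eop, eoa, pt_zero] at this
    · have h3 := hae hpos
      have i1 : m2 ≤ n := by
        by_contra h
        push Not at h
        nlinarith
      have i2 : n ≤ ma := by
        by_contra h
        push Not at h
        nlinarith
      have o2 : o ≤ s2 := by nlinarith [mul_nonneg (sub_nonneg.2 i1) hpos.le]
      have o1 : l ≤ o := by nlinarith [mul_nonneg (sub_nonneg.2 i2) hpos.le]
      have h4 := hla o o1 o2
      rw [← eoa, ← pt_zero o n] at h4
      have := sees_pt_sub h4.symm hpos.le le_rfl p0 (by linarith)
      rwa [eop, eoa] at this
  · have hle : ma < m1 ∧ ∀ y, 0 ≤ y → s1 + m1 * y ≤ l + ma * y → l + ma * y ≤ s2 + m2 * y := by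
      rcases lt_or_gt_of_ne ha0 with hneg | hpos
      · have : ma ≤ m2 := by
          by_contra h
          push Not at h
          nlinarith
        refine ⟨by linarith, fun y y0 _ => by nlinarith⟩
      · have h3 := hae hpos
        have h4 : l + ma * a.2 ≤ s1 + m1 * a.2 := by nlinarith
        have h5 : ma < m1 := by
          by_contra h
          push Not at h
          nlinarith
        refine ⟨h5, fun y y0 hy => ?_⟩
        have h6 : y ≤ a.2 := by
          by_contra h
          push Not at h
          nlinarith
        have h7 : m2 ≤ ma := by
          by_contra h
          push Not at h
          nlinarith
        nlinarith
    have hls : s1 < l := by nlinarith [hle.1]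
    have hsub : Tri s1 m1 l ma ⊆ Tri s1 m1 t mm := by
      rintro y ⟨y0, y1, y2⟩
      refine ⟨y0, y1, ?_⟩
      have h1 := hle.2 y.2 y0 (by linarith)
      have h2 : y.2 ≤ e := by
        by_contra h
        push Not at h
        nlinarith
      have := hin y.2 y0 (by linarith)
      linarith
    have := hmin (hvalid hls hle.1 (hsub.trans hsub1)) ⟨p0, q1, hcase.le⟩
    linarith


open Filter Topology

theorem frontier_meets {X : Type*} [TopologicalSpace X] {t s : Set X} (ht : IsPreconnected t)
    (h1 : (t ∩ s).Nonempty) (h2 : (t ∩ sᶜ).Nonempty) : (t ∩ frontier s).Nonempty := by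
  by_contra hne
  rw [Set.not_nonempty_iff_eq_empty] at hne
  have hcov : ∀ x ∈ t, x ∈ interior s ∨ x ∈ (closure s)ᶜ := by
    intro x hx
    by_cases h : x ∈ closure s
    · left
      by_contra h'
      have : x ∈ t ∩ frontier s := ⟨hx, h, h'⟩
      rw [hne] at this
      exact this
    · exact Or.inr h
  obtain ⟨a, hat, has⟩ := h1
  obtain ⟨b, hbt, hbs⟩ := h2
  obtain ⟨z, -, hz1, hz2⟩ := ht (interior s) (closure s)ᶜ isOpen_interior
    isClosed_closure.isOpen_compl hcov
    ⟨a, hat, (hcov a hat).resolve_right fun h => h (subset_closure has)⟩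
    ⟨b, hbt, (hcov b hbt).resolve_left fun h => hbs (interior_subset h)⟩
  exact hz2 (subset_closure (interior_subset hz1))

/-- `b*(h - z.2) + X*z.2 - h*z.1`: nonnegative iff `z` is left of the line from `(b,0)` to `(X,h)`. -/
def FF (X h b : ℝ) (z : ℝ × ℝ) : ℝ := b * (h - z.2) + X * z.2 - h * z.1

theorem FF_cont (X h b : ℝ) : Continuous (FF X h b) := by unfold FF; fun_prop

theorem FF_diff (X h b b' : ℝ) (z : ℝ × ℝ) : FF X h b' z = FF X h b z + (b' - b) * (h - z.2) := by
  unfold FF; ring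

theorem FF_aff (X h b : ℝ) (x y : ℝ × ℝ) (θ : ℝ) :
    FF X h b (x.1 + θ * (y.1 - x.1), x.2 + θ * (y.2 - x.2)) =
      (1 - θ) * FF X h b x + θ * FF X h b y := by
  unfold FF; simp only; ring

/-- no vertex near the side: the window extends -/
theorem extend_window {K V : Set (ℝ × ℝ)} {u w α β b' X h : ℝ}
    (hc : IsCompact K)
    (hintr : ∀ q, u < q → q < w → ((q, 0) : ℝ × ℝ) ∈ interior K)
    (hfr : ∀ x ∈ frontier K, ∃ e1 ∈ V, ∃ e2 ∈ V, x ∈ segment ℝ e1 e2 ∧ segment ℝ e1 e2 ⊆ frontier K)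
    (hu : u < α) (hαβ : α < β) (hb : β < b') (hw : b' < w) (hh : 0 < h)
    (hT : ∀ z : ℝ × ℝ, 0 < z.2 → FF X h α z < 0 → 0 < FF X h β z → z ∈ interior K)
    (hXK : (X, h) ∈ K)
    (hV : ∀ v ∈ V, v.2 < 0 ∨ 0 < FF X h β v ∨ FF X h b' v < 0) : Sees K (X, h) (b', 0) := by
  have hdisj : ∀ z, z ∈ frontier K → z ∉ interior K := by
    intro z hz
    rw [hc.isClosed.frontier_eq] at hz
    exact hz.2
  -- base points
  have hbase : ∀ z : ℝ × ℝ, z.2 = 0 → FF X h β z ≤ 0 → 0 < FF X h b' z → z ∈ interior K := by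
    intro z h0 h1 h2
    have : z = (z.1, 0) := by ext <;> simp [h0]
    unfold FF at h1 h2
    rw [h0] at h1 h2
    rw [this]
    apply hintr
    · nlinarith
    · nlinarith
  -- no frontier point in the thin triangle
  have main : ∀ x, x ∈ frontier K → 0 ≤ x.2 → FF X h β x ≤ 0 → 0 < FF X h b' x → False := by
    intro x hx x0 x1 x2
    have xpos : 0 < x.2 := by
      rcases x0.eq_or_lt with h | h
      · exact absurd (hbase x h.symm x1 x2) (hdisj x hx)
      · exact h
    obtain ⟨v, hvV, hvb, hvs⟩ : ∃ v ∈ V, 0 < FF X h b' v ∧ segment ℝ x v ⊆ frontier K := by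
      obtain ⟨e1, he1, e2, he2, hxe, hes⟩ := hfr x hx
      have s1 : segment ℝ x e1 ⊆ frontier K :=
        ((convex_segment _ _).segment_subset hxe (left_mem_segment _ _ _)).trans hes
      have s2 : segment ℝ x e2 ⊆ frontier K :=
        ((convex_segment _ _).segment_subset hxe (right_mem_segment _ _ _)).trans hes
      by_cases h1 : 0 < FF X h b' e1
      · exact ⟨e1, he1, h1, s1⟩
      · refine ⟨e2, he2, ?_, s2⟩
        obtain ⟨θ, t0, t1, f1, f2⟩ := seg_iff.1 hxe
        have : FF X h b' x = (1 - θ) * FF X h b' e1 + θ * FF X h b' e2 := by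
          rw [← FF_aff, ← f1, ← f2]
        push Not at h1
        by_contra h2
        push Not at h2
        nlinarith
    set r : ℝ → ℝ × ℝ := fun θ => (x.1 + θ * (v.1 - x.1), x.2 + θ * (v.2 - x.2)) with hr
    have hrc : Continuous r := by rw [hr]; fun_prop
    have hrf : ∀ θ, 0 ≤ θ → θ ≤ 1 → r θ ∈ frontier K := fun θ h0 h1 =>
      hvs (seg_iff.2 ⟨θ, h0, h1, rfl, rfl⟩)
    have hrb : ∀ θ, 0 ≤ θ → θ ≤ 1 → 0 < FF X h b' (r θ) := by
      intro θ h0 h1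
      rw [hr]; simp only; rw [FF_aff]
      rcases h0.eq_or_lt with h | h
      · rw [← h]; simpa using x2
      · nlinarith [mul_pos h hvb, mul_nonneg (sub_nonneg.2 h1) x2.le]
    have star1 : ∀ θ, 0 ≤ θ → θ ≤ 1 → FF X h β (r θ) ≤ 0 → 0 < (r θ).2 := by
      intro θ h0 h1 h2
      by_contra h3
      push Not at h3
      have e3 : (r θ).2 = x.2 + θ * (v.2 - x.2) := rfl
      rw [e3] at h3
      have hneg : v.2 - x.2 < 0 := by
        by_contra h
        push Not at h
        nlinarith
      obtain ⟨τ, hτ⟩ : ∃ τ, τ * (x.2 - v.2) = x.2 := ⟨x.2 / (x.2 - v.2), by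
        have : x.2 - v.2 ≠ 0 := by linarith
        field_simp⟩
      have τ0 : 0 < τ := by
        by_contra h
        push Not at h
        nlinarith
      have τθ : τ ≤ θ := by
        by_contra h
        push Not at h
        nlinarith
      have e4 : (r τ).2 = 0 := by
        show x.2 + τ * (v.2 - x.2) = 0
        linarith
      have e5 : FF X h β (r τ) ≤ 0 := by
        have a1 : FF X h β (r τ) = (1 - τ) * FF X h β x + τ * FF X h β v := FF_aff _ _ _ _ _ _
        have a2 : FF X h β (r θ) = (1 - θ) * FF X h β x + θ * FF X h β v := FF_aff _ _ _ _ _ _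
        have a3 : θ * FF X h β (r τ) = (θ - τ) * FF X h β x + τ * FF X h β (r θ) := by
          rw [a1, a2]; ring
        have : θ * FF X h β (r τ) ≤ 0 := by
          rw [a3]
          have := mul_nonneg (sub_nonneg.2 τθ) (neg_nonneg.2 x1)
          have := mul_nonneg τ0.le (neg_nonneg.2 h2)
          linarith
        by_contra h
        push Not at h
        nlinarith
      exact hdisj _ (hrf τ τ0.le (by linarith)) (hbase _ e4 e5 (hrb τ τ0.le (by linarith)))
    have r1 : r 1 = v := by rw [hr]; ext <;> simp
    have hvβ : 0 < FF X h β v := by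
      by_contra h
      push Not at h
      have := star1 1 zero_le_one le_rfl (by rwa [r1])
      rw [r1] at this
      rcases hV v hvV with h | h | h <;> linarith
    obtain ⟨τ, hτ⟩ : ∃ τ, τ * (FF X h β v - FF X h β x) = - FF X h β x :=
      ⟨- FF X h β x / (FF X h β v - FF X h β x), by
        have : FF X h β v - FF X h β x ≠ 0 := by linarith
        field_simp⟩
    have τ0 : 0 ≤ τ := by
      by_contra h
      push Not at h
      nlinarith
    have τ1 : τ < 1 := by
      by_contra h
      push Not at h
      nlinarith
    have a1 : ∀ τ, FF X h β (r τ) = (1 - τ) * FF X h β x + τ * FF X h β v :=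
      fun τ => FF_aff _ _ _ _ _ _
    have z0 : FF X h β (r τ) = 0 := by rw [a1]; linarith
    have zy := star1 τ τ0 τ1.le z0.le
    have zb := hrb τ τ0 τ1.le
    have zh : (r τ).2 < h := by
      rw [FF_diff X h β b', z0] at zb
      by_contra h
      push Not at h
      nlinarith
    have zα : FF X h α (r τ) < 0 := by
      rw [FF_diff X h β α, z0]
      nlinarith
    have ev1 : ∀ᶠ θ in 𝓝[>] τ, 0 < (r θ).2 :=
      nhdsWithin_le_nhds ((continuous_snd.comp hrc).continuousAt.eventually (lt_mem_nhds zy))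
    have ev2 : ∀ᶠ θ in 𝓝[>] τ, FF X h α (r θ) < 0 :=
      nhdsWithin_le_nhds (((FF_cont X h α).comp hrc).continuousAt.eventually (gt_mem_nhds zα))
    have ev3 : ∀ᶠ θ in 𝓝[>] τ, θ < 1 := nhdsWithin_le_nhds (gt_mem_nhds τ1)
    have ev4 : ∀ᶠ θ in 𝓝[>] τ, τ < θ := self_mem_nhdsWithin
    obtain ⟨θ, t1, t2, t3, t4⟩ := (ev1.and (ev2.and (ev3.and ev4))).exists
    refine hdisj _ (hrf θ (by linarith) t3.le) (hT _ t1 t2 ?_)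
    rw [a1]
    nlinarith
  -- conclude
  intro m hm
  by_contra hmK
  obtain ⟨θ, t0, t1, f1, f2⟩ := seg_iff.1 hm
  simp only at f1 f2
  have hbK : ((b', 0) : ℝ × ℝ) ∈ K := interior_subset (hintr b' (by linarith) hw)
  have t0' : 0 < θ := by
    rcases t0.eq_or_lt with h0 | h0
    · exfalso
      apply hmK
      have : m = (X, h) := by ext <;> simp [f1, f2, ← h0]
      rwa [this]
    · exact h0
  have t1' : θ < 1 := by
    rcases t1.eq_or_lt with h | h
    · exfalso
      apply hmK
      have : m = (b', 0) := by ext <;> simp [f1, f2, h]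
      rwa [this]
    · exact h
  have g1 : FF X h b' m = 0 := by unfold FF; rw [f1, f2]; ring
  have m0 : 0 < m.2 := by rw [f2]; nlinarith
  have g2 : FF X h β m < 0 := by
    rw [FF_diff X h b' β, g1, f2]
    have := mul_pos (sub_pos.2 hb) (mul_pos t0' hh)
    linarith
  set r : ℝ → ℝ × ℝ := fun ε => (m.1 - ε, m.2) with hr
  have hrc : Continuous r := by rw [hr]; fun_prop
  have r0 : r 0 = m := by rw [hr]; simp
  have ev1 : ∀ᶠ ε in 𝓝[>] (0:ℝ), r ε ∈ Kᶜ :=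
    nhdsWithin_le_nhds (hrc.continuousAt.eventually (hc.isClosed.isOpen_compl.mem_nhds (by
      rw [r0]; exact hmK)))
  have ev2 : ∀ᶠ ε in 𝓝[>] (0:ℝ), FF X h β (r ε) < 0 :=
    nhdsWithin_le_nhds (((FF_cont X h β).comp hrc).continuousAt.eventually (gt_mem_nhds (by
      simp only [Function.comp]; rw [r0]; exact g2)))
  have ev3 : ∀ᶠ ε in 𝓝[>] (0:ℝ), 0 < ε := self_mem_nhdsWithin
  obtain ⟨ε, e1, e2, e3⟩ := (ev1.and (ev2.and ev3)).exists
  have e4 : 0 < FF X h b' (r ε) := by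
    have : FF X h b' (r ε) = FF X h b' m + h * ε := by rw [hr]; unfold FF; simp only; ring
    rw [this, g1]
    have := mul_pos hh e3
    linarith
  have hβK : ((β, 0) : ℝ × ℝ) ∈ K := interior_subset (hintr β (by linarith) (by linarith))
  have hpre : IsPreconnected (segment ℝ ((β, 0) : ℝ × ℝ) (r ε)) := (convex_segment _ _).isPreconnected
  obtain ⟨x, hxs, hxf⟩ := frontier_meets hpre
    (s := K) ⟨_, left_mem_segment _ _ _, hβK⟩ ⟨_, right_mem_segment _ _ _, e1⟩
  obtain ⟨τ, s0, s1, x1, x2⟩ := seg_iff.1 hxs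
  have ex : x = (((β, 0) : ℝ × ℝ).1 + τ * ((r ε).1 - ((β, 0) : ℝ × ℝ).1),
      ((β, 0) : ℝ × ℝ).2 + τ * ((r ε).2 - ((β, 0) : ℝ × ℝ).2)) := by
    ext
    · exact x1
    · exact x2
  have c1 : FF X h β (β, 0) = 0 := by unfold FF; simp only; ring
  have c2 : FF X h b' (β, 0) = (b' - β) * h := by unfold FF; simp only; ring
  have rε : (r ε).2 = m.2 := rfl
  refine main x hxf ?_ ?_ ?_
  · rw [x2, rε]; simp only; nlinarith
  · rw [ex, FF_aff, c1]; nlinarith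
  · rw [ex, FF_aff, c2]
    have := mul_pos (sub_pos.2 hb) hh
    rcases s0.eq_or_lt with h | h
    · rw [← h]; linarith
    · nlinarith [mul_pos h e4, mul_nonneg (sub_nonneg.2 s1) this.le]

theorem vertex_lemma {K V : Set (ℝ × ℝ)} {u w : ℝ} (hc : IsCompact K) (hQ : Quad K) (hax : Ax K)
    (hwv : ∀ p ∈ K, ∃ o : ℝ, u ≤ o ∧ o ≤ w ∧ Sees K p (o, 0))
    (hintr : ∀ q, u < q → q < w → ((q, 0) : ℝ × ℝ) ∈ interior K) (hVf : V.Finite)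
    (hfr : ∀ x ∈ frontier K, ∃ e1 ∈ V, ∃ e2 ∈ V, x ∈ segment ℝ e1 e2 ∧ segment ℝ e1 e2 ⊆ frontier K)
    {s m' t m : ℝ} (hst : s < t) (hm : m < m') (hT : Tri s m' t m ⊆ K) :
    ∃ z, (z ∈ V ∨ z = (u, 0) ∨ z = (w, 0)) ∧ ∀ p ∈ Tri s m' t m, Sees K z p := by
  obtain ⟨h, hh⟩ : ∃ h, h * (m' - m) = t - s := ⟨(t - s) / (m' - m), by
    have : m' - m ≠ 0 := by linarith
    field_simp⟩
  have h0 : 0 < h := by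
    by_contra h
    push Not at h
    nlinarith
  obtain ⟨X, hX⟩ : ∃ X, X = s + m' * h := ⟨_, rfl⟩
  have hX' : X = t + m * h := by linarith
  have hZT : (X, h) ∈ Tri s m' t m := ⟨h0.le, hX.ge, hX'.le⟩
  have hZK := hT hZT
  have hsT : ((s, 0) : ℝ × ℝ) ∈ Tri s m' t m := by
    refine ⟨le_rfl, ?_, ?_⟩ <;> simp
    exact hst.le
  have htT : ((t, 0) : ℝ × ℝ) ∈ Tri s m' t m := by
    refine ⟨le_rfl, ?_, ?_⟩ <;> simp
    exact hst.le
  obtain ⟨q, q1, q2, hq⟩ := hwv _ hZK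
  obtain ⟨-, hW⟩ := win hc hQ hax ⟨q, hq⟩
  set α := lo K (X, h)
  set β := hi K (X, h)
  have hαs : α ≤ s := ((hW s).1 ((tri_seg hZT hsT).trans hT)).1
  have hβt : t ≤ β := ((hW t).1 ((tri_seg hZT htT).trans hT)).2
  have hqw := (hW q).1 hq
  have hα : Sees K (X, h) (α, 0) := (hW α).2 ⟨le_rfl, by linarith⟩
  have hβ : Sees K (X, h) (β, 0) := (hW β).2 ⟨by linarith, le_rfl⟩
  obtain ⟨k', hk'⟩ : ∃ k', α + k' * h = X := ⟨(X - α) / h, by field_simp; ring⟩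
  obtain ⟨k, hk⟩ : ∃ k, β + k * h = X := ⟨(X - β) / h, by field_simp; ring⟩
  have hαβ : α < β := by linarith
  have hkk : k < k' := by
    by_contra h
    push Not at h
    nlinarith
  have hbig : Tri α k' β k ⊆ K := by
    have e : pt α k' h = (X, h) := by ext <;> simp [pt, hk']
    refine tri_sub hQ (h := h) hαβ hkk (by linarith) (hax _ _ hα.right hβ.right) ?_ ?_
    · rw [e]; exact hα.symm
    · rw [e]; exact hβ.symm
  have hle : Tri s m' t m ⊆ Tri α k' β k := by
    rintro z ⟨z0, z1, z2⟩
    have zh : z.2 ≤ h := by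
      by_contra h
      push Not at h
      nlinarith
    refine ⟨z0, ?_, ?_⟩
    · have : h * (α + k' * z.2) ≤ h * z.1 := by
        have e1 : h * (α + k' * z.2) = α * (h - z.2) + X * z.2 := by rw [← hk']; ring
        have e2 : h * (s + m' * z.2) = s * (h - z.2) + X * z.2 := by rw [hX]; ring
        nlinarith
      exact le_of_mul_le_mul_left this h0
    · have : h * z.1 ≤ h * (β + k * z.2) := by
        have e1 : h * (β + k * z.2) = β * (h - z.2) + X * z.2 := by rw [← hk]; ring
        have e2 : h * (t + m * z.2) = t * (h - z.2) + X * z.2 := by rw [hX']; ring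
        nlinarith
      exact le_of_mul_le_mul_left this h0
  have hfin : ∀ z ∈ Tri α k' β k, ∀ p ∈ Tri s m' t m, Sees K z p := fun z hz p hp =>
    (tri_seg hz (hle hp)).trans hbig
  have hbase : ∀ o, α ≤ o → o ≤ β → ((o, 0) : ℝ × ℝ) ∈ Tri α k' β k := by
    intro o h1 h2
    refine ⟨le_rfl, ?_, ?_⟩ <;> simp <;> assumption
  by_cases hu : α ≤ u
  · exact ⟨(u, 0), Or.inr (Or.inl rfl), hfin _ (hbase u hu (by linarith))⟩
  by_cases hw : w ≤ β
  · exact ⟨(w, 0), Or.inr (Or.inr rfl), hfin _ (hbase w (by linarith) hw)⟩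
  push Not at hu hw
  by_cases hv : ∃ v ∈ V, v ∈ Tri α k' β k
  · obtain ⟨v, v1, v2⟩ := hv
    exact ⟨v, Or.inl v1, hfin v v2⟩
  exfalso
  push Not at hv
  have ev : ∀ᶠ b in 𝓝[>] β, ∀ v ∈ V, v.2 < 0 ∨ 0 < FF X h β v ∨ FF X h b v < 0 := by
    rw [Filter.eventually_all_finite hVf]
    intro v hvV
    have evp : ∀ᶠ b in 𝓝[>] β, β < b := self_mem_nhdsWithin
    by_cases c1 : v.2 < 0
    · exact Filter.Eventually.of_forall fun b => Or.inl c1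
    by_cases c2 : 0 < FF X h β v
    · exact Filter.Eventually.of_forall fun b => Or.inr (Or.inl c2)
    push Not at c1 c2
    rcases c2.lt_or_eq with c3 | c3
    · have hcont : Continuous (fun b => FF X h b v) := by unfold FF; fun_prop
      have : ∀ᶠ b in 𝓝[>] β, FF X h b v < 0 :=
        nhdsWithin_le_nhds (hcont.continuousAt.eventually (gt_mem_nhds c3))
      exact this.mono fun b hb => Or.inr (Or.inr hb)
    · refine evp.mono fun b hb => Or.inr (Or.inr ?_)
      rw [FF_diff X h β b, c3]
      have : h < v.2 := by
        by_contra hc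
        push Not at hc
        apply hv v hvV
        have e3 : h * v.1 = h * (β + k * v.2) := by
          unfold FF at c3
          have e1 : h * (β + k * v.2) = β * (h - v.2) + X * v.2 := by rw [← hk]; ring
          linarith
        have e4 := mul_left_cancel₀ h0.ne' e3
        refine ⟨c1, ?_, e4.le⟩
        rw [e4]
        have : h * (α + k' * v.2) ≤ h * (β + k * v.2) := by
          have e1 : h * (β + k * v.2) = β * (h - v.2) + X * v.2 := by rw [← hk]; ring
          have e2 : h * (α + k' * v.2) = α * (h - v.2) + X * v.2 := by rw [← hk']; ring
          nlinarith
        exact le_of_mul_le_mul_left this h0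
      nlinarith
  have ev2 : ∀ᶠ b in 𝓝[>] β, β < b := self_mem_nhdsWithin
  have ev3 : ∀ᶠ b in 𝓝[>] β, b < w := nhdsWithin_le_nhds (gt_mem_nhds hw)
  obtain ⟨b, b1, b2, b3⟩ := (ev.and (ev2.and ev3)).exists
  have hTint : ∀ z : ℝ × ℝ, 0 < z.2 → FF X h α z < 0 → 0 < FF X h β z → z ∈ interior K := by
    intro z z0 z1 z2
    refine tri_int hbig z0 ?_ ?_
    · have : h * (α + k' * z.2) < h * z.1 := by
        have e2 : h * (α + k' * z.2) = α * (h - z.2) + X * z.2 := by rw [← hk']; ring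
        unfold FF at z1; linarith
      exact lt_of_mul_lt_mul_left this h0.le
    · have : h * z.1 < h * (β + k * z.2) := by
        have e1 : h * (β + k * z.2) = β * (h - z.2) + X * z.2 := by rw [← hk]; ring
        unfold FF at z2; linarith
      exact lt_of_mul_lt_mul_left this h0.le
  have := extend_window hc hintr hfr hu hαβ b2 b3 h0 hTint hZK b1
  have := ((hW b).1 this).2
  linarith


open Filter Topology

theorem half {K V : Set (ℝ × ℝ)} {u w : ℝ} (hc : IsCompact K) (hQ : Quad K) (hax : Ax K)
    (hwv : ∀ p ∈ K, ∃ o : ℝ, u ≤ o ∧ o ≤ w ∧ Sees K p (o, 0))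
    (hintr : ∀ q, u < q → q < w → ((q, 0) : ℝ × ℝ) ∈ interior K) (hVf : V.Finite)
    (hfr : ∀ x ∈ frontier K, ∃ e1 ∈ V, ∃ e2 ∈ V, x ∈ segment ℝ e1 e2 ∧ segment ℝ e1 e2 ⊆ frontier K)
    (G : Finset (ℝ × ℝ)) (hGf : ∀ g ∈ G, g ∈ frontier K)
    (hguard : ∀ x ∈ frontier K, ∃ g ∈ G, Sees K g x) :
    ∃ z : ℝ × ℝ → ℝ × ℝ, (∀ g, z g ∈ V ∨ z g = (u, 0) ∨ z g = (w, 0)) ∧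
      ∀ p ∈ K, 0 < p.2 → (∃ g ∈ G, Sees K g p) ∨ ∃ g ∈ G, Sees K (z g) p := by
  classical
  have hwv' : ∀ p ∈ K, ∃ o : ℝ, Sees K p (o, 0) := fun p hp => by
    obtain ⟨o, -, -, h⟩ := hwv p hp
    exact ⟨o, h⟩
  let Un : ℝ × ℝ → Prop := fun p => p ∈ K ∧ 0 < p.2 ∧ ∀ g ∈ G, ¬ Sees K g p
  let Mn : ℝ × ℝ → ℝ × ℝ → ℝ × ℝ → Prop := fun p a c => a ∈ G ∧ c ∈ G ∧ Valid K a c ∧ p ∈ TT K a c ∧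
    ∀ a' ∈ G, ∀ c' ∈ G, Valid K a' c' → p ∈ TT K a' c' → lo K c - hi K a ≤ lo K c' - hi K a'
  have hMn : ∀ p, Un p → ∃ a c, Mn p a c := by
    intro p hp
    obtain ⟨a, ha, c, hcG, hv, hpt⟩ := exists_pair hc hQ hax hwv' G hguard hp.1 hp.2.1 hp.2.2
    let S : Finset ((ℝ × ℝ) × (ℝ × ℝ)) := (G ×ˢ G).filter fun x => Valid K x.1 x.2 ∧ p ∈ TT K x.1 x.2
    obtain ⟨x, hx, hmin⟩ := S.exists_min_image (fun x => lo K x.2 - hi K x.1)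
      ⟨(a, c), by simp [S, ha, hcG, hv, hpt]⟩
    simp only [S, Finset.mem_filter, Finset.mem_product] at hx hmin
    exact ⟨x.1, x.2, hx.1.1, hx.1.2, hx.2.1, hx.2.2, fun a' ha' c' hc' h1 h2 =>
      hmin (a', c') ⟨⟨ha', hc'⟩, h1, h2⟩⟩
  have key : ∀ c, ∃ z, (z ∈ V ∨ z = (u, 0) ∨ z = (w, 0)) ∧ ∀ p, Un p → ∀ a, Mn p a c → Sees K z p := by
    intro c
    let C : Set (ℝ × ℝ) := {a | ∃ p, Un p ∧ Mn p a c}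
    have hCf : C.Finite := G.finite_toSet.subset fun a ⟨p, _, h⟩ => h.1
    by_cases hne : C.Nonempty
    · obtain ⟨a, haC, hamax⟩ := hCf.exists_maximalFor (fun a => TT K a c) C hne
      have aux : ∀ a1 a2, a1 ∈ C → a2 ∈ C → hi K a1 < hi K a2 → TT K a2 c ⊆ TT K a1 c := by
        rintro a1 a2 ⟨p1, hp1, hM1⟩ ⟨p2, hp2, hM2⟩ hlt
        obtain ⟨g1, -, v1, pt1, mn1⟩ := hM1
        obtain ⟨g2, gc, v2, pt2, mn2⟩ := hM2
        refine nest hc hQ hax hwv' v1 v2 (hGf _ g2) hp1.2.1 pt1 (hp1.2.2 _ g2) hlt ?_ ?_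
        · intro h
          have := mn1 _ g2 _ gc v2 h
          linarith
        · intro h1 h2
          exact mn1 _ g1 _ g2 h1 h2
      have hgreat : ∀ b ∈ C, TT K b c ⊆ TT K a c := by
        intro b hb
        rcases lt_trichotomy (hi K a) (hi K b) with h | h | h
        · exact aux a b haC hb h
        · rcases le_total (mr K a) (mr K b) with h' | h'
          · rintro z ⟨z0, z1, z2⟩
            exact ⟨z0, by rw [h]; nlinarith, z2⟩
          · apply hamax hb
            rintro z ⟨z0, z1, z2⟩
            exact ⟨z0, by rw [← h]; nlinarith, z2⟩
        · exact hamax hb (aux b a hb haC h)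
      obtain ⟨p0, hp0, hM0⟩ := haC
      obtain ⟨z, hz1, hz2⟩ := vertex_lemma hc hQ hax hwv hintr hVf hfr hM0.2.2.1.base
        hM0.2.2.1.slope hM0.2.2.1.sub
      refine ⟨z, hz1, fun p hp b hb => hz2 p (hgreat b ⟨p, hp, hb⟩ hb.2.2.2.1)⟩
    · refine ⟨(u, 0), Or.inr (Or.inl rfl), fun p hp a ha => ?_⟩
      exact absurd ⟨a, p, hp, ha⟩ hne
  choose z hz1 hz2 using key
  refine ⟨z, hz1, fun p hpK hp0 => ?_⟩
  by_cases h : ∃ g ∈ G, Sees K g p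
  · exact Or.inl h
  · right
    push Not at h
    have hU : Un p := ⟨hpK, hp0, h⟩
    obtain ⟨a, c, hM⟩ := hMn p hU
    exact ⟨c, hM.2.1, hz2 c p hU a hM⟩

/-- flip -/
def fl : (ℝ × ℝ) ≃ₜ (ℝ × ℝ) := (Homeomorph.refl ℝ).prodCongr (Homeomorph.neg ℝ)

theorem fl_apply (z : ℝ × ℝ) : fl z = (z.1, -z.2) := rfl

theorem fl_fl (z : ℝ × ℝ) : fl (fl z) = z := by simp [fl_apply]

theorem fl_seg {a b z : ℝ × ℝ} (h : z ∈ segment ℝ a b) : fl z ∈ segment ℝ (fl a) (fl b) := by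
  obtain ⟨θ, t0, t1, e1, e2⟩ := seg_iff.1 h
  refine seg_iff.2 ⟨θ, t0, t1, ?_, ?_⟩
  · simp only [fl_apply]; rw [e1]
  · simp only [fl_apply]; rw [e2]; ring

theorem fl_sees {K : Set (ℝ × ℝ)} {a b : ℝ × ℝ} : Sees (fl ⁻¹' K) a b ↔ Sees K (fl a) (fl b) := by
  constructor
  · intro h z hz
    have := h (fl_seg hz |> fun h => by rwa [fl_fl, fl_fl] at h)
    rwa [Set.mem_preimage, fl_fl] at this
  · intro h z hz
    exact h (fl_seg hz)

theorem fl_quad {K : Set (ℝ × ℝ)} (hQ : Quad K) : Quad (fl ⁻¹' K) := by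
  intro a b c d h h1 h2 h3 h4
  rw [fl_sees] at *
  refine hQ _ _ _ _ ?_ h1 h2 h3 h4
  have : ∀ x y z, dt (fl x) (fl y) (fl z) = - dt x y z := by
    intro x y z; unfold dt; simp only [fl_apply]; ring
  rw [this, this]
  linarith

theorem fl_ax {K : Set (ℝ × ℝ)} (h : Ax K) : Ax (fl ⁻¹' K) := by
  intro a b ha hb
  rw [fl_sees]
  have e : ∀ x : ℝ, fl (x, 0) = (x, 0) := fun x => by simp [fl_apply]
  rw [Set.mem_preimage] at ha hb
  rw [e] at ha hb
  rw [e, e]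
  exact h _ _ ha hb

theorem core {K V : Set (ℝ × ℝ)} {u w : ℝ} (hc : IsCompact K) (hQ : Quad K) (hax : Ax K)
    (hreg : K = closure (interior K))
    (hwv : ∀ p ∈ K, ∃ o : ℝ, u ≤ o ∧ o ≤ w ∧ Sees K p (o, 0))
    (hintr : ∀ q, u < q → q < w → ((q, 0) : ℝ × ℝ) ∈ interior K) (hVf : V.Finite)
    (hfr : ∀ x ∈ frontier K, ∃ e1 ∈ V, ∃ e2 ∈ V, x ∈ segment ℝ e1 e2 ∧ segment ℝ e1 e2 ⊆ frontier K)
    (G : Finset (ℝ × ℝ)) (hGf : ∀ g ∈ G, g ∈ frontier K)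
    (hguard : ∀ x ∈ frontier K, ∃ g ∈ G, Sees K g x) :
    ∃ G' : Finset (ℝ × ℝ), (∀ g ∈ G', g ∈ V ∨ g = (u, 0) ∨ g = (w, 0)) ∧
      G'.card ≤ 2 * G.card ∧ ∀ p ∈ K, ∃ g, (g ∈ G ∨ g ∈ G') ∧ Sees K g p := by
  classical
  have e : ∀ x : ℝ, fl (x, 0) = (x, 0) := fun x => by simp [fl_apply]
  obtain ⟨z, hz1, hz2⟩ := half hc hQ hax hwv hintr hVf hfr G hGf hguard
  obtain ⟨z', hz1', hz2'⟩ := half (K := fl ⁻¹' K) (V := fl ⁻¹' V) (u := u) (w := w)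
    (fl.isCompact_preimage.2 hc) (fl_quad hQ) (fl_ax hax)
    (by
      intro p hp
      obtain ⟨o, o1, o2, o3⟩ := hwv _ hp
      refine ⟨o, o1, o2, ?_⟩
      rw [fl_sees, e]; exact o3)
    (by
      intro q q1 q2
      rw [← fl.preimage_interior, Set.mem_preimage, e]
      exact hintr q q1 q2)
    (hVf.preimage fl.injective.injOn)
    (by
      intro x hx
      rw [← fl.preimage_frontier] at hx ⊢
      obtain ⟨e1, h1, e2, h2, h3, h4⟩ := hfr _ hx
      refine ⟨fl e1, by rwa [Set.mem_preimage, fl_fl], fl e2, by rwa [Set.mem_preimage, fl_fl], ?_, ?_⟩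
      · have := fl_seg h3
        rwa [fl_fl] at this
      · intro y hy
        have := fl_seg hy
        rw [fl_fl, fl_fl] at this
        exact h4 this)
    (G.image fl)
    (by
      intro g hg
      obtain ⟨g0, h0, rfl⟩ := Finset.mem_image.1 hg
      rw [← fl.preimage_frontier, Set.mem_preimage, fl_fl]
      exact hGf _ h0)
    (by
      intro x hx
      rw [← fl.preimage_frontier] at hx
      obtain ⟨g, hg, hs⟩ := hguard _ hx
      refine ⟨fl g, Finset.mem_image_of_mem _ hg, ?_⟩
      rwa [fl_sees, fl_fl])
  refine ⟨G.image z ∪ G.image (fun g => fl (z' (fl g))), ?_, ?_, ?_⟩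
  · intro g hg
    rcases Finset.mem_union.1 hg with h | h
    · obtain ⟨g0, -, rfl⟩ := Finset.mem_image.1 h
      exact hz1 g0
    · obtain ⟨g0, -, rfl⟩ := Finset.mem_image.1 h
      rcases hz1' (fl g0) with h | h | h
      · exact Or.inl h
      · right; left; simp only [h, e]
      · right; right; simp only [h, e]
  · refine (Finset.card_union_le _ _).trans ?_
    have := Finset.card_image_le (s := G) (f := z)
    have := Finset.card_image_le (s := G) (f := fun g => fl (z' (fl g)))
    omega
  · set G' := G.image z ∪ G.image (fun g => fl (z' (fl g))) with hG'
    have hcl : IsClosed (⋃ g ∈ G ∪ G', {p | Sees K g p}) :=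
      isClosed_biUnion_finset fun g _ => (sees_closed hc.isClosed).preimage
        (f := fun p => (g, p)) (by fun_prop)
    have hne : ∀ p ∈ K, p.2 ≠ 0 → p ∈ ⋃ g ∈ G ∪ G', {p | Sees K g p} := by
      intro p hp h0
      rw [Set.mem_iUnion₂]
      rcases lt_or_gt_of_ne h0 with h | h
      · rcases hz2' (fl p) (by rwa [Set.mem_preimage, fl_fl]) (by simpa [fl_apply] using h) with
          ⟨g, hg, hs⟩ | ⟨g, hg, hs⟩
        · obtain ⟨g0, h0, rfl⟩ := Finset.mem_image.1 hg
          rw [fl_sees, fl_fl, fl_fl] at hs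
          exact ⟨g0, Finset.mem_union_left _ h0, hs⟩
        · obtain ⟨g0, h0, rfl⟩ := Finset.mem_image.1 hg
          rw [fl_sees, fl_fl] at hs
          exact ⟨_, Finset.mem_union_right _ (Finset.mem_union_right _
            (Finset.mem_image_of_mem _ h0)), hs⟩
      · rcases hz2 p hp h with ⟨g, hg, hs⟩ | ⟨g, hg, hs⟩
        · exact ⟨g, Finset.mem_union_left _ hg, hs⟩
        · exact ⟨_, Finset.mem_union_right _ (Finset.mem_union_left _
            (Finset.mem_image_of_mem _ hg)), hs⟩
    have hall : K ⊆ ⋃ g ∈ G ∪ G', {p | Sees K g p} := by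
      intro p hp
      rw [hreg] at hp
      refine closure_minimal ?_ hcl hp
      intro x hx
      rw [← hcl.closure_eq]
      have hlim : Tendsto (fun ε : ℝ => (x.1, x.2 + ε)) (𝓝[≠] 0) (𝓝 x) := by
        have hcont : Continuous (fun ε : ℝ => (x.1, x.2 + ε)) := by fun_prop
        have := hcont.tendsto 0
        simp only [add_zero] at this
        exact this.mono_left nhdsWithin_le_nhds
      refine mem_closure_of_tendsto hlim ?_
      have ev1 := hlim.eventually (isOpen_interior.mem_nhds hx)
      have ev2 : ∀ᶠ ε in 𝓝[≠] (0:ℝ), x.2 + ε ≠ 0 := by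
        by_cases h : x.2 = 0
        · rw [h]
          have : ∀ᶠ ε in 𝓝[≠] (0:ℝ), ε ≠ 0 := self_mem_nhdsWithin
          simpa using this
        · have hcont : Continuous (fun ε : ℝ => x.2 + ε) := by fun_prop
          refine nhdsWithin_le_nhds (hcont.continuousAt.eventually
            (isOpen_ne.mem_nhds (by simpa using h)))
      filter_upwards [ev1, ev2] with ε h1 h2
      exact hne _ (interior_subset h1) h2
    intro p hp
    obtain ⟨g, hg, hs⟩ := Set.mem_iUnion₂.1 (hall hp)
    exact ⟨g, Finset.mem_union.1 hg, hs⟩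


open Filter Topology

theorem compl_preconn {X : Type*} [TopologicalSpace X] [PreconnectedSpace X] {K : Set X}
    (hK : IsClosed K)
    (hf : IsPreconnected (frontier K))
    (hloc : ∀ x ∈ frontier K, ∃ U ∈ 𝓝 x, IsPreconnected (U \ K)) : IsPreconnected Kᶜ := by
  intro A B hA hB hcov hAne hBne
  by_contra hdis
  rw [Set.not_nonempty_iff_eq_empty] at hdis
  have hdis' : ∀ x, x ∉ K → x ∈ A → x ∈ B → False := by
    intro x h1 h2 h3
    have : x ∈ Kᶜ ∩ (A ∩ B) := ⟨h1, h2, h3⟩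
    rw [hdis] at this
    exact this
  have key : ∀ A B : Set X, IsOpen A → IsOpen B → (∀ x, x ∉ K → x ∈ A ∨ x ∈ B) →
      (∀ x, x ∉ K → x ∈ A → x ∈ B → False) → (Kᶜ ∩ A).Nonempty → (Kᶜ ∩ B).Nonempty →
      (frontier K ∩ closure (Kᶜ ∩ A)).Nonempty := by
    intro A B hA hB hcov hd hAn hBn
    obtain ⟨x, -, hx⟩ := frontier_meets (t := Set.univ) (s := Kᶜ ∩ A) isPreconnected_univ
      (by simpa using hAn) (by
        obtain ⟨b, b1, b2⟩ := hBn
        exact ⟨b, trivial, fun h => hd b b1 h.2 b2⟩)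
    have hx1 : x ∈ closure (Kᶜ ∩ A) := hx.1
    have hx2 : x ∉ Kᶜ ∩ A := by
      have := hx.2
      rwa [(hK.isOpen_compl.inter hA).interior_eq] at this
    refine ⟨x, ?_, hx1⟩
    have hxK : x ∈ K := by
      by_contra hxK
      rcases hcov x hxK with h | h
      · exact hx2 ⟨hxK, h⟩
      · obtain ⟨y, y2, y3⟩ := mem_closure_iff.1 hx1 B hB h
        exact hd y y3.1 y3.2 y2
    rw [frontier_eq_closure_inter_closure]
    exact ⟨subset_closure hxK, closure_mono Set.inter_subset_left hx1⟩
  have hcov' : ∀ x, x ∉ K → x ∈ A ∨ x ∈ B := fun x hx => hcov hx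
  obtain ⟨x, hxf, hxA, hxB⟩ := isPreconnected_closed_iff.1 hf (closure (Kᶜ ∩ A)) (closure (Kᶜ ∩ B))
    isClosed_closure isClosed_closure
    (by
      intro x hx
      rw [← closure_union, ← Set.inter_union_distrib_left, Set.inter_eq_left.2 hcov]
      rw [frontier_eq_closure_inter_closure] at hx
      exact hx.2)
    (key A B hA hB hcov' hdis' hAne hBne)
    (key B A hB hA (fun x hx => (hcov' x hx).symm) (fun x h1 h2 h3 => hdis' x h1 h3 h2) hBne hAne)
  obtain ⟨U, hU, hUp⟩ := hloc x hxf
  obtain ⟨y, y1, y2⟩ := mem_closure_iff_nhds.1 hxA U hU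
  obtain ⟨z, z1, z2⟩ := mem_closure_iff_nhds.1 hxB U hU
  obtain ⟨t, t1, t2, t3⟩ := hUp A B hA hB (fun t ht => hcov ht.2) ⟨y, ⟨y1, y2.1⟩, y2.2⟩
    ⟨z, ⟨z1, z2.1⟩, z2.2⟩
  exact hdis' t t1.2 t2 t3

theorem para {x a z : ℝ × ℝ} (hne : a ≠ x) (h : dt x a z = 0) :
    ∃ θ : ℝ, z.1 = x.1 + θ * (a.1 - x.1) ∧ z.2 = x.2 + θ * (a.2 - x.2) := by
  unfold dt at h
  by_cases hx : a.1 - x.1 = 0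
  · have hy : a.2 - x.2 ≠ 0 := by
      intro hy; apply hne; ext <;> linarith
    refine ⟨(z.2 - x.2) / (a.2 - x.2), ?_, by field_simp; ring⟩
    have : (a.2 - x.2) * (z.1 - x.1) = 0 := by rw [hx] at h; linarith
    rcases mul_eq_zero.1 this with h | h
    · exact absurd h hy
    · rw [hx]; linarith
  · refine ⟨(z.1 - x.1) / (a.1 - x.1), by field_simp; ring, ?_⟩
    field_simp
    linarith

theorem dt_convex (x a : ℝ × ℝ) : Convex ℝ {z | 0 < dt x a z} := by
  rw [convex_iff_segment_subset]
  intro y hy z hz p hp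
  obtain ⟨θ, t0, t1, e1, e2⟩ := seg_iff.1 hp
  have hy' : 0 < dt x a y := hy
  have hz' : 0 < dt x a z := hz
  show 0 < dt x a p
  have : dt x a p = (1 - θ) * dt x a y + θ * dt x a z := by unfold dt; rw [e1, e2]; ring
  rw [this]
  rcases t0.eq_or_lt with h | h
  · rw [← h]; linarith
  · nlinarith [mul_pos h hz', mul_nonneg (sub_nonneg.2 t1) hy'.le]

theorem dt_swap (x a z : ℝ × ℝ) (θ : ℝ) (b : ℝ × ℝ) (h1 : z.1 = x.1 + θ * (b.1 - x.1))
    (h2 : z.2 = x.2 + θ * (b.2 - x.2)) : dt x a z = θ * dt x a b := by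
  unfold dt; rw [h1, h2]; ring

theorem sector {x a b : ℝ × ℝ} {ε : ℝ} (hε : 0 < ε) (hax : a ≠ x) (hbx : b ≠ x)
    (ha : a ∉ Metric.ball x ε) (hb : b ∉ Metric.ball x ε)
    (hab : segment ℝ x a ∩ segment ℝ x b ⊆ {x}) (hD : 0 ≤ dt x a b) :
    ∃ S1 S2 : Set (ℝ × ℝ), IsPreconnected S1 ∧ IsPreconnected S2 ∧
      Metric.ball x ε \ (segment ℝ x a ∪ segment ℝ x b) = S1 ∪ S2 := by
  -- points on the ray in the ball are on the segment
  have hray : ∀ c : ℝ × ℝ, c ∉ Metric.ball x ε → ∀ z ∈ Metric.ball x ε, ∀ θ : ℝ, 0 ≤ θ →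
      z.1 = x.1 + θ * (c.1 - x.1) → z.2 = x.2 + θ * (c.2 - x.2) → z ∈ segment ℝ x c := by
    intro c hc z hz θ h0 h1 h2
    rw [seg_iff]
    refine ⟨θ, h0, ?_, h1, h2⟩
    by_contra hθ
    push Not at hθ
    apply hc
    refine (convex_ball x ε).segment_subset (Metric.mem_ball_self hε) hz ?_
    rw [seg_iff]
    refine ⟨1 / θ, by positivity, by rw [div_le_one (by linarith)]; exact hθ.le, ?_, ?_⟩
    · rw [h1]; field_simp; ring
    · rw [h2]; field_simp; ring
  have conv : ∀ c d : ℝ × ℝ, Convex ℝ (Metric.ball x ε ∩ {z | 0 < dt c d z}) := fun c d =>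
    (convex_ball x ε).inter (dt_convex c d)
  have anti : ∀ c d z : ℝ × ℝ, dt c d z = - dt d c z := fun c d z => by unfold dt; ring
  rcases hD.eq_or_lt with hD | hD
  · obtain ⟨κ, k1, k2⟩ := para hax hD.symm
    have hκ : κ < 0 := by
      by_contra hκ
      push Not at hκ
      rcases hκ.eq_or_lt with h | h
      · apply hbx
        ext <;> simp [k1, k2, ← h]
      · set s := min 1 κ with hs
        have s0 : 0 < s := lt_min zero_lt_one h
        have s1 : s ≤ 1 := min_le_left _ _
        have s2 : s ≤ κ := min_le_right _ _
        have : ((x.1 + s * (a.1 - x.1), x.2 + s * (a.2 - x.2)) : ℝ × ℝ) ∈ ({x} : Set (ℝ × ℝ)) := by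
          apply hab
          refine ⟨seg_iff.2 ⟨s, s0.le, s1, rfl, rfl⟩, seg_iff.2 ⟨s / κ, by positivity,
            (div_le_one h).2 s2, ?_, ?_⟩⟩
          · simp only; rw [k1]; field_simp; ring
          · simp only; rw [k2]; field_simp; ring
        rw [Set.mem_singleton_iff] at this
        have e1 := congrArg Prod.fst this
        have e2 := congrArg Prod.snd this
        simp only at e1 e2
        apply hax
        ext
        · have : s * (a.1 - x.1) = 0 := by linarith
          rcases mul_eq_zero.1 this with h | h <;> linarith
        · have : s * (a.2 - x.2) = 0 := by linarith
          rcases mul_eq_zero.1 this with h | h <;> linarith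
    refine ⟨_, _, (conv x a).isPreconnected, (conv a x).isPreconnected, ?_⟩
    ext z
    constructor
    · rintro ⟨hz, hn⟩
      rcases lt_trichotomy (dt x a z) 0 with h | h | h
      · right; exact ⟨hz, show 0 < dt a x z by rw [anti]; linarith⟩
      · exfalso
        apply hn
        obtain ⟨θ, t1, t2⟩ := para hax h
        rcases le_total 0 θ with h0 | h0
        · exact Or.inl (hray a ha z hz θ h0 t1 t2)
        · refine Or.inr (hray b hb z hz (θ / κ) (div_nonneg_of_nonpos h0 hκ.le) ?_ ?_)
          · have := hκ.ne
            rw [t1, k1]; field_simp; ring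
          · have := hκ.ne
            rw [t2, k2]; field_simp; ring
      · left; exact ⟨hz, h⟩
    · intro h
      have hz : z ∈ Metric.ball x ε := by rcases h with h | h <;> exact h.1
      have hne : dt x a z ≠ 0 := by
        rcases h with h | h
        · have : 0 < dt x a z := h.2
          exact this.ne'
        · have : 0 < dt a x z := h.2
          rw [anti]; linarith
      refine ⟨hz, ?_⟩
      rintro (h | h)
      · obtain ⟨θ, _, _, t1, t2⟩ := seg_iff.1 h
        apply hne
        rw [dt_swap x a z θ a t1 t2]
        unfold dt; ring
      · obtain ⟨θ, _, _, t1, t2⟩ := seg_iff.1 h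
        apply hne
        rw [dt_swap x a z θ b t1 t2, ← hD]
        ring
  · have hBA : dt x b a = - dt x a b := by unfold dt; ring
    have haa : dt x a a = 0 := by unfold dt; ring
    have hbb : dt x b b = 0 := by unfold dt; ring
    refine ⟨Metric.ball x ε ∩ {z | 0 < dt x a z} ∩ {z | 0 < dt b x z},
      (Metric.ball x ε ∩ {z | 0 < dt a x z}) ∪ (Metric.ball x ε ∩ {z | 0 < dt x b z}),
      ((conv x a).inter (dt_convex b x)).isPreconnected, ?_, ?_⟩
    · -- common point
      set r : ℝ → ℝ × ℝ := fun δ => (x.1 - δ * ((a.1 - x.1) + (b.1 - x.1)),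
        x.2 - δ * ((a.2 - x.2) + (b.2 - x.2))) with hr
      have hrc : Continuous r := by rw [hr]; fun_prop
      have r0 : r 0 = x := by rw [hr]; ext <;> simp
      have ev1 : ∀ᶠ δ in 𝓝[>] (0:ℝ), r δ ∈ Metric.ball x ε :=
        nhdsWithin_le_nhds (hrc.continuousAt.eventually (Metric.isOpen_ball.mem_nhds (by
          rw [r0]; exact Metric.mem_ball_self hε)))
      have ev2 : ∀ᶠ δ in 𝓝[>] (0:ℝ), 0 < δ := self_mem_nhdsWithin
      obtain ⟨δ, d1, d2⟩ := (ev1.and ev2).exists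
      refine IsPreconnected.union (r δ) ⟨d1, ?_⟩ ⟨d1, ?_⟩ (conv a x).isPreconnected
        (conv x b).isPreconnected
      · show 0 < dt a x (r δ)
        have : dt a x (r δ) = δ * dt x a b := by rw [hr]; unfold dt; simp only; ring
        rw [this]; positivity
      · show 0 < dt x b (r δ)
        have : dt x b (r δ) = δ * dt x a b := by rw [hr]; unfold dt; simp only; ring
        rw [this]; positivity
    · ext z
      constructor
      · rintro ⟨hz, hn⟩
        by_cases hA : 0 < dt a x z
        · exact Or.inr (Or.inl ⟨hz, hA⟩)
        by_cases hB : 0 < dt x b z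
        · exact Or.inr (Or.inr ⟨hz, hB⟩)
        left
        rw [anti] at hA
        push Not at hA hB
        refine ⟨⟨hz, ?_⟩, ?_⟩
        · show 0 < dt x a z
          by_contra hc
          have h0 : dt x a z = 0 := by linarith
          obtain ⟨θ, t1, t2⟩ := para hax h0
          have e := dt_swap x b z θ a t1 t2
          rw [hBA] at e
          have : 0 ≤ θ := by
            by_contra hc
            push Not at hc
            nlinarith
          exact hn (Or.inl (hray a ha z hz θ this t1 t2))
        · show 0 < dt b x z
          rw [anti]
          by_contra hc
          have h0 : dt x b z = 0 := by linarith
          obtain ⟨θ, t1, t2⟩ := para hbx h0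
          have e := dt_swap x a z θ b t1 t2
          have : 0 ≤ θ := by
            by_contra hc
            push Not at hc
            nlinarith
          exact hn (Or.inr (hray b hb z hz θ this t1 t2))
      · intro h
        have hz : z ∈ Metric.ball x ε := by
          rcases h with h | h | h
          · exact h.1.1
          · exact h.1
          · exact h.1
        have h' : (0 < dt x a z ∧ dt x b z < 0) ∨ dt x a z < 0 ∨ 0 < dt x b z := by
          rcases h with h | h | h
          · left
            have h1 : 0 < dt x a z := h.1.2
            have h2 : 0 < dt b x z := h.2
            rw [anti] at h2
            exact ⟨h1, by linarith⟩
          · right; left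
            have h2 : 0 < dt a x z := h.2
            rw [anti] at h2
            linarith
          · right; right
            exact h.2
        refine ⟨hz, ?_⟩
        rintro (h | h)
        · obtain ⟨θ, s0, _, t1, t2⟩ := seg_iff.1 h
          have e1 := dt_swap x a z θ a t1 t2
          have e2 := dt_swap x b z θ a t1 t2
          rw [haa, mul_zero] at e1
          rw [hBA] at e2
          have := mul_nonneg s0 hD.le
          rcases h' with h' | h' | h' <;> linarith
        · obtain ⟨θ, s0, _, t1, t2⟩ := seg_iff.1 h
          have e1 := dt_swap x a z θ b t1 t2
          have e2 := dt_swap x b z θ b t1 t2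
          rw [hbb, mul_zero] at e2
          have := mul_nonneg s0 hD.le
          rcases h' with h' | h' | h' <;> linarith

theorem sector' {x a b : ℝ × ℝ} {ε : ℝ} (hε : 0 < ε) (hax : a ≠ x) (hbx : b ≠ x)
    (ha : a ∉ Metric.ball x ε) (hb : b ∉ Metric.ball x ε)
    (hab : segment ℝ x a ∩ segment ℝ x b ⊆ {x}) :
    ∃ S1 S2 : Set (ℝ × ℝ), IsPreconnected S1 ∧ IsPreconnected S2 ∧
      Metric.ball x ε \ (segment ℝ x a ∪ segment ℝ x b) = S1 ∪ S2 := by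
  rcases le_total 0 (dt x a b) with h | h
  · exact sector hε hax hbx ha hb hab h
  · rw [Set.union_comm]
    rw [Set.inter_comm] at hab
    refine sector hε hbx hax hb ha hab ?_
    have : dt x b a = - dt x a b := by unfold dt; ring
    linarith

theorem local_conn {K : Set (ℝ × ℝ)} (hK : IsClosed K) (hreg : K = closure (interior K))
    {x a b : ℝ × ℝ} (hax : a ≠ x) (hbx : b ≠ x) (hab : segment ℝ x a ∩ segment ℝ x b ⊆ {x})
    (hxK : x ∈ K) (hsub : segment ℝ x a ∪ segment ℝ x b ⊆ frontier K)
    {N : Set (ℝ × ℝ)} (hN : N ∈ 𝓝 x) (hfr : frontier K ∩ N ⊆ segment ℝ x a ∪ segment ℝ x b) :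
    ∃ U ∈ 𝓝 x, IsPreconnected (U \ K) := by
  have hM : N ∩ {a}ᶜ ∩ {b}ᶜ ∈ 𝓝 x :=
    inter_mem (inter_mem hN (isOpen_compl_singleton.mem_nhds hax.symm))
      (isOpen_compl_singleton.mem_nhds hbx.symm)
  obtain ⟨ε, hε, hball⟩ := Metric.mem_nhds_iff.1 hM
  obtain ⟨S1, S2, h1, h2, hS⟩ := sector' hε hax hbx (fun h => (hball h).1.2 rfl)
    (fun h => (hball h).2 rfl) hab
  refine ⟨Metric.ball x ε, Metric.ball_mem_nhds x hε, ?_⟩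
  have hnf : ∀ y ∈ S1 ∪ S2, y ∉ frontier K := by
    intro y hy hyf
    rw [← hS] at hy
    exact hy.2 (hfr ⟨hyf, (hball hy.1).1.1⟩)
  have dich : ∀ S ⊆ S1 ∪ S2, IsPreconnected S → S ⊆ K ∨ S ⊆ Kᶜ := by
    intro S hSS hSp
    by_contra hcon
    push Not at hcon
    obtain ⟨⟨y, y1, y2⟩, ⟨z, z1, z2⟩⟩ := And.intro (Set.not_subset.1 hcon.1) (Set.not_subset.1 hcon.2)
    obtain ⟨t, t1, t2⟩ := frontier_meets hSp ⟨z, z1, not_not.1 z2⟩ ⟨y, y1, y2⟩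
    exact hnf t (hSS t1) t2
  have heq : Metric.ball x ε \ K = (S1 \ K) ∪ (S2 \ K) := by
    rw [← Set.union_diff_distrib, ← hS]
    ext y
    constructor
    · rintro ⟨y1, y2⟩
      exact ⟨⟨y1, fun h => y2 (hK.frontier_subset (hsub h))⟩, y2⟩
    · rintro ⟨⟨y1, _⟩, y2⟩
      exact ⟨y1, y2⟩
  rw [heq]
  rcases dich S1 Set.subset_union_left h1 with d1 | d1
  · rw [Set.diff_eq_empty.2 d1, Set.empty_union]
    rcases dich S2 Set.subset_union_right h2 with d2 | d2
    · rw [Set.diff_eq_empty.2 d2]; exact isPreconnected_empty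
    · rw [(Set.disjoint_left.2 fun y hy => d2 hy : Disjoint S2 K).sdiff_eq_left]; exact h2
  · rw [(Set.disjoint_left.2 fun y hy => d1 hy : Disjoint S1 K).sdiff_eq_left]
    rcases dich S2 Set.subset_union_right h2 with d2 | d2
    · rw [Set.diff_eq_empty.2 d2, Set.union_empty]; exact h1
    · exfalso
      rw [hreg] at hxK
      obtain ⟨y, y1, y2⟩ := mem_closure_iff_nhds.1 hxK _ (Metric.ball_mem_nhds x hε)
      by_cases hy : y ∈ segment ℝ x a ∪ segment ℝ x b
      · exact (hsub hy).2 y2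
      · have : y ∈ S1 ∪ S2 := by rw [← hS]; exact ⟨y1, hy⟩
        rcases this with h | h
        · exact d1 h (interior_subset y2)
        · exact d2 h (interior_subset y2)


open Filter Topology

theorem seg_union {a b x : ℝ × ℝ} (hx : x ∈ segment ℝ a b) :
    segment ℝ x a ∪ segment ℝ x b = segment ℝ a b := by
  apply Set.Subset.antisymm
  · apply Set.union_subset
    · exact (convex_segment a b).segment_subset hx (left_mem_segment _ _ _)
    · exact (convex_segment a b).segment_subset hx (right_mem_segment _ _ _)
  · have hr : x ∈ Set.range (AffineMap.lineMap a b : ℝ → ℝ × ℝ) := by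
      rw [segment_eq_image_lineMap] at hx
      obtain ⟨t, -, ht⟩ := hx
      exact ⟨t, ht⟩
    have h := openSegment_subset_union a b hr
    rw [← insert_endpoints_openSegment]
    intro y hy
    rcases hy with rfl | rfl | hy
    · left; exact right_mem_segment _ _ _
    · right; exact right_mem_segment _ _ _
    · rcases h hy with rfl | hy | hy
      · left; exact left_mem_segment _ _ _
      · left; rw [segment_symm]; exact openSegment_subset_segment _ _ _ hy
      · right; exact openSegment_subset_segment _ _ _ hy

theorem seg_inter {a b x : ℝ × ℝ} (hx : x ∈ segment ℝ a b) :
    segment ℝ x a ∩ segment ℝ x b ⊆ {x} := by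
  rintro z ⟨h1, h2⟩
  rw [segment_symm] at h1
  have h3 := (mem_segment_iff_wbtw.1 hx).trans_left_right (mem_segment_iff_wbtw.1 h1)
  exact (wbtw_swap_left_iff ℝ b).1 ⟨h3, mem_segment_iff_wbtw.1 h2⟩

theorem poly_compl {n : ℕ} [NeZero n] {K : Set (ℝ × ℝ)} {v : Fin n → ℝ × ℝ} (hn : 3 ≤ n)
    (hinj : Function.Injective v) (hc : IsCompact K) (hreg : K = closure (interior K))
    (hfr : frontier K = ⋃ i : Fin n, segment ℝ (v i) (v (i + 1)))
    (hcon : ∀ i : Fin n, segment ℝ (v i) (v (i + 1)) ∩ segment ℝ (v (i + 1)) (v (i + 1 + 1))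
      = {v (i + 1)})
    (hdis : ∀ i j : Fin n, i ≠ j → j ≠ i + 1 → i ≠ j + 1 →
      Disjoint (segment ℝ (v i) (v (i + 1))) (segment ℝ (v j) (v (j + 1)))) :
    IsPreconnected Kᶜ := by
  have h10 : ∀ i : Fin n, i + 1 ≠ i := by
    intro i h
    have h1 : (1 : Fin n) = 0 := by simpa using h
    have := congrArg Fin.val h1
    rw [Fin.val_one', Fin.val_zero, Nat.mod_eq_of_lt (by omega)] at this
    omega
  have h20 : ∀ i : Fin n, i + 1 + 1 ≠ i := by
    intro i h
    have h1 : (1 : Fin n) + 1 = 0 := by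
      rw [add_assoc] at h
      simpa using h
    have := congrArg Fin.val h1
    rw [Fin.val_add, Fin.val_one', Fin.val_zero, Nat.mod_eq_of_lt (show 1 < n by omega),
      Nat.mod_eq_of_lt (by omega)] at this
    omega
  have segcl : ∀ a b : ℝ × ℝ, IsClosed (segment ℝ a b) := by
    intro a b
    rw [← convexHull_pair]
    exact ((Set.toFinite {a, b}).isCompact_convexHull (𝕜 := ℝ)).isClosed
  have hsub : ∀ i, segment ℝ (v i) (v (i + 1)) ⊆ frontier K := by
    intro i
    rw [hfr]
    exact Set.subset_iUnion (fun i => segment ℝ (v i) (v (i + 1))) i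
  apply compl_preconn hc.isClosed
  · have : frontier K = ⋃ k : ℕ, segment ℝ (v (Fin.ofNat n k)) (v (Fin.ofNat n k + 1)) := by
      rw [hfr]
      apply Set.Subset.antisymm
      · apply Set.iUnion_subset
        intro i
        refine Set.Subset.trans ?_ (Set.subset_iUnion _ (i : ℕ))
        simp
      · apply Set.iUnion_subset
        intro k
        exact Set.subset_iUnion (fun i => segment ℝ (v i) (v (i + 1))) (Fin.ofNat n k)
    rw [this]
    apply IsPreconnected.iUnion_of_chain
    · intro k
      exact (convex_segment _ _).isPreconnected
    · intro k
      refine ⟨v (Fin.ofNat n k + 1), right_mem_segment _ _ _, ?_⟩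
      have : Fin.ofNat n (Order.succ k) = Fin.ofNat n k + 1 := by
        apply Fin.ext
        simp [Fin.val_add]
      rw [this]
      exact left_mem_segment _ _ _
  · intro x hx
    have hxK : x ∈ K := hc.isClosed.frontier_subset hx
    have hx' := hx
    rw [hfr] at hx'
    obtain ⟨i, hi⟩ := Set.mem_iUnion.1 hx'
    -- vertex case
    have vert : ∀ i, x = v (i + 1) → ∃ U ∈ 𝓝 x, IsPreconnected (U \ K) := by
      intro i hxi
      have hcl : IsClosed (⋃ k ∈ {k : Fin n | k ≠ i ∧ k ≠ i + 1}, segment ℝ (v k) (v (k + 1))) :=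
        (Set.toFinite _).isClosed_biUnion (fun _ _ => segcl _ _)
      refine local_conn hc.isClosed hreg (x := x) (a := v i) (b := v (i + 1 + 1)) ?_ ?_ ?_ hxK ?_
        (N := (⋃ k ∈ {k : Fin n | k ≠ i ∧ k ≠ i + 1}, segment ℝ (v k) (v (k + 1)))ᶜ) ?_ ?_
      · rw [hxi]; exact fun h => h10 i (hinj h).symm
      · rw [hxi]; exact fun h => h10 (i + 1) (hinj h)
      · rw [hxi, segment_symm ℝ (v (i + 1)) (v i), hcon]
      · rw [hxi, segment_symm ℝ (v (i + 1)) (v i)]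
        exact Set.union_subset (hsub _) (hsub _)
      · apply hcl.isOpen_compl.mem_nhds
        intro h
        obtain ⟨k, hk, hxk⟩ := Set.mem_iUnion₂.1 h
        obtain ⟨hk1, hk2⟩ : k ≠ i ∧ k ≠ i + 1 := hk
        have hxi' : x ∈ segment ℝ (v i) (v (i + 1)) := by rw [hxi]; exact right_mem_segment _ _ _
        by_cases hki : i = k + 1
        · have : x ∈ segment ℝ (v k) (v (k + 1)) ∩ segment ℝ (v (k + 1)) (v (k + 1 + 1)) := by
            refine ⟨hxk, ?_⟩
            rwa [← hki]
          rw [hcon, ← hki] at this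
          have h2 : x = v i := this
          exact h10 i (hinj (hxi.symm.trans h2))
        · exact Set.disjoint_left.1 (hdis i k hk1.symm hk2 hki) hxi' hxk
      · rintro y ⟨hy1, hy2⟩
        rw [hfr] at hy1
        obtain ⟨k, hk⟩ := Set.mem_iUnion.1 hy1
        by_cases hk1 : k = i
        · left; rw [hxi, segment_symm, ← hk1]; exact hk
        by_cases hk2 : k = i + 1
        · right; rw [hxi, ← hk2]; exact hk
        · exact absurd (Set.mem_iUnion₂.2 ⟨k, ⟨hk1, hk2⟩, hk⟩) hy2
    by_cases hx1 : x = v (i + 1)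
    · exact vert i hx1
    by_cases hx0 : x = v i
    · exact vert (i - 1) (by rw [sub_add_cancel]; exact hx0)
    have hcl : IsClosed (⋃ k ∈ {k : Fin n | k ≠ i}, segment ℝ (v k) (v (k + 1))) :=
      (Set.toFinite _).isClosed_biUnion (fun _ _ => segcl _ _)
    have hun : segment ℝ x (v i) ∪ segment ℝ x (v (i + 1)) = segment ℝ (v i) (v (i + 1)) := seg_union hi
    refine local_conn hc.isClosed hreg (x := x) (a := v i) (b := v (i + 1)) (Ne.symm hx0)
      (Ne.symm hx1) ?_ hxK ?_
      (N := (⋃ k ∈ {k : Fin n | k ≠ i}, segment ℝ (v k) (v (k + 1)))ᶜ) ?_ ?_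
    · exact seg_inter hi
    · rw [hun]; exact hsub i
    · apply hcl.isOpen_compl.mem_nhds
      intro h
      obtain ⟨k, hk, hxk⟩ := Set.mem_iUnion₂.1 h
      have hk1 : k ≠ i := hk
      by_cases hki : i = k + 1
      · have : x ∈ segment ℝ (v k) (v (k + 1)) ∩ segment ℝ (v (k + 1)) (v (k + 1 + 1)) := by
          refine ⟨hxk, ?_⟩
          rwa [← hki]
        rw [hcon, ← hki] at this
        exact hx0 this
      by_cases hki : k = i + 1
      · have : x ∈ segment ℝ (v i) (v (i + 1)) ∩ segment ℝ (v (i + 1)) (v (i + 1 + 1)) := by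
          refine ⟨hi, ?_⟩
          rwa [← hki]
        rw [hcon] at this
        exact hx1 this
      · exact Set.disjoint_left.1 (hdis i k hk1.symm hki (by assumption)) hi hxk
    · rintro y ⟨hy1, hy2⟩
      rw [hfr] at hy1
      obtain ⟨k, hk⟩ := Set.mem_iUnion.1 hy1
      rw [hun]
      by_cases hk1 : k = i
      · rw [← hk1]; exact hk
      · exact absurd (Set.mem_iUnion₂.2 ⟨k, hk1, hk⟩) hy2

theorem ax_of_wv {K : Set (ℝ × ℝ)} {u w : ℝ} (huw : u ≤ w) (hch : Sees K (u, 0) (w, 0))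
    (hwv : ∀ p ∈ K, ∃ o : ℝ, u ≤ o ∧ o ≤ w ∧ Sees K p (o, 0)) : Ax K := by
  have key : ∀ a b : ℝ, a ≤ b → (a, 0) ∈ K → (b, 0) ∈ K → Sees K (a, 0) (b, 0) := by
    intro a b hab ha hb z hz
    obtain ⟨h1, h2, h3⟩ := mem_ax hab hz
    obtain ⟨p, p1, p2, p3⟩ := hwv _ ha
    obtain ⟨q, q1, q2, q3⟩ := hwv _ hb
    rw [h3]
    by_cases hzu : z.1 < u
    · exact p3 (ax_mem h1 (by linarith))
    by_cases hzw : w < z.1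
    · exact q3.symm (ax_mem (by linarith) h2)
    push Not at hzu hzw
    exact hch (ax_mem hzu hzw)
  intro a b ha hb
  rcases le_total a b with h | h
  · exact key a b h ha hb
  · exact (key b a h hb ha).symm

theorem poly_core {n : ℕ} [NeZero n] {K : Set (ℝ × ℝ)} {v : Fin n → ℝ × ℝ} (hn : 3 ≤ n)
    (hinj : Function.Injective v) (hc : IsCompact K) (hreg : K = closure (interior K))
    (hfr : frontier K = ⋃ i : Fin n, segment ℝ (v i) (v (i + 1)))
    (hcon : ∀ i : Fin n, segment ℝ (v i) (v (i + 1)) ∩ segment ℝ (v (i + 1)) (v (i + 1 + 1))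
      = {v (i + 1)})
    (hdis : ∀ i j : Fin n, i ≠ j → j ≠ i + 1 → i ≠ j + 1 →
      Disjoint (segment ℝ (v i) (v (i + 1))) (segment ℝ (v j) (v (j + 1))))
    (hu : ((0 : ℝ), (0 : ℝ)) ∈ K) (hw : ((1 : ℝ), (0 : ℝ)) ∈ K)
    (hintr : ∀ q : ℝ, 0 < q → q < 1 → (q, (0 : ℝ)) ∈ interior K)
    (hwv : ∀ p ∈ K, ∃ o : ℝ, 0 ≤ o ∧ o ≤ 1 ∧ Sees K p (o, 0))
    (G : Finset (ℝ × ℝ)) (hGf : ∀ g ∈ G, g ∈ frontier K)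
    (hguard : ∀ x ∈ frontier K, ∃ g ∈ G, Sees K g x) :
    ∃ G' : Finset (ℝ × ℝ), (∀ g ∈ G', g ∈ Set.range v ∨ g = (0, 0) ∨ g = (1, 0)) ∧
      G'.card ≤ 2 * G.card ∧ ∀ p ∈ K, ∃ g, (g ∈ G ∨ g ∈ G') ∧ Sees K g p := by
  have hQ : Quad K := quad_of_compl (poly_compl hn hinj hc hreg hfr hcon hdis) hc.isBounded
  have hch : Sees K ((0 : ℝ), (0 : ℝ)) (1, 0) := by
    intro z hz
    obtain ⟨h1, h2, h3⟩ := mem_ax zero_le_one hz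
    rw [h3]
    rcases h1.eq_or_lt with h1 | h1
    · rw [← h1]; exact hu
    rcases h2.eq_or_lt with h2 | h2
    · rw [h2]; exact hw
    · exact interior_subset (hintr _ h1 h2)
  refine core hc hQ (ax_of_wv zero_le_one hch hwv) hreg hwv hintr (Set.finite_range v) ?_ G hGf
    hguard
  intro x hx
  rw [hfr] at hx
  obtain ⟨i, hi⟩ := Set.mem_iUnion.1 hx
  refine ⟨v i, ⟨i, rfl⟩, v (i + 1), ⟨i + 1, rfl⟩, hi, ?_⟩
  rw [hfr]
  exact Set.subset_iUnion (fun i => segment ℝ (v i) (v (i + 1))) i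


open Filter Topology

/-- Coordinates on the Euclidean plane adapted to the chord. -/
noncomputable def chart (u d : EuclideanSpace ℝ (Fin 2)) (p : ℝ × ℝ) : EuclideanSpace ℝ (Fin 2) :=
  !₂[u 0 + p.1 * d 0 - p.2 * d 1, u 1 + p.1 * d 1 + p.2 * d 0]

noncomputable def chartHomeo (u d : EuclideanSpace ℝ (Fin 2)) (hd : d 0 ^ 2 + d 1 ^ 2 ≠ 0) :
    (ℝ × ℝ) ≃ₜ EuclideanSpace ℝ (Fin 2) where
  toFun := chart u d
  invFun x := (((x 0 - u 0) * d 0 + (x 1 - u 1) * d 1) / (d 0 ^ 2 + d 1 ^ 2),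
    ((x 1 - u 1) * d 0 - (x 0 - u 0) * d 1) / (d 0 ^ 2 + d 1 ^ 2))
  left_inv p := by
    ext <;> simp [chart] <;> field_simp <;> ring
  right_inv x := by
    ext i
    fin_cases i <;> simp [chart] <;> field_simp <;> ring
  continuous_toFun := by
    unfold chart
    fun_prop
  continuous_invFun := by
    fun_prop

theorem chart_seg (u d : EuclideanSpace ℝ (Fin 2)) (hd : d 0 ^ 2 + d 1 ^ 2 ≠ 0) (a b : ℝ × ℝ) :
    chartHomeo u d hd '' segment ℝ a b =
      segment ℝ (chartHomeo u d hd a) (chartHomeo u d hd b) := by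
  have key : ∀ s t : ℝ, s + t = 1 → chartHomeo u d hd (s • a + t • b) =
      s • chartHomeo u d hd a + t • chartHomeo u d hd b := by
    intro s t hst
    obtain rfl : s = 1 - t := by linarith
    ext i
    fin_cases i <;> simp [chartHomeo, chart] <;> ring
  ext z
  constructor
  · rintro ⟨y, ⟨s, t, hs, ht, hst, rfl⟩, rfl⟩
    exact ⟨s, t, hs, ht, hst, (key s t hst).symm⟩
  · rintro ⟨s, t, hs, ht, hst, rfl⟩
    exact ⟨_, ⟨s, t, hs, ht, hst, rfl⟩, key s t hst⟩

end Helpers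

theorem chord_wv_polygon_guarding {n : ℕ} [NeZero n]
    (P : Set (EuclideanSpace ℝ (Fin 2))) (v : Fin n → EuclideanSpace ℝ (Fin 2))
    (hP : IsSimplePolygonRegion P v)
    (u w : EuclideanSpace ℝ (Fin 2))
    -- `[u, w]` is a chord of `P`
    (hu : u ∈ frontier P) (hw : w ∈ frontier P)
    (hchord : segment ℝ u w \ {u, w} ⊆ interior P)
    -- `P` is weakly visible from the chord `[u, w]`
    (hwv : ∀ p ∈ P, ∃ q ∈ segment ℝ u w, segment ℝ q p ⊆ P)
    (G : Finset (EuclideanSpace ℝ (Fin 2)))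
    (hG_bd : ↑G ⊆ frontier P)
    (hG_guards : ∀ x ∈ frontier P, ∃ g ∈ G, segment ℝ g x ⊆ P) :
    ∃ G' : Finset (EuclideanSpace ℝ (Fin 2)),
      ↑G' ⊆ Set.range v ∪ {u, w} ∧ G'.card ≤ 2 * G.card ∧
      ∀ p ∈ P, ∃ g ∈ (↑G ∪ ↑G' : Set (EuclideanSpace ℝ (Fin 2))), segment ℝ g p ⊆ P := by
  classical
  obtain ⟨hn, hinj, hc, -, hreg, hfr, hcon, hdis⟩ := hP
  have hPcl : IsClosed P := hc.isClosed
  by_cases huw : u = w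
  · subst huw
    obtain ⟨g, hg, -⟩ := hG_guards u hu
    have hcard : 1 ≤ G.card := Finset.card_pos.2 ⟨g, hg⟩
    refine ⟨{u}, ?_, ?_, ?_⟩
    · intro x hx
      right
      simpa using hx
    · rw [Finset.card_singleton]; omega
    · intro p hp
      obtain ⟨q, hq, hqp⟩ := hwv p hp
      rw [segment_same] at hq
      have hq' : q = u := hq
      subst hq'
      exact ⟨q, Or.inr (by simp), hqp⟩
  have hd : (w - u) 0 ^ 2 + (w - u) 1 ^ 2 ≠ 0 := by
    intro h
    apply huw
    have h0 : (w - u) 0 = 0 := by nlinarith [sq_nonneg ((w - u) 0), sq_nonneg ((w - u) 1)]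
    have h1 : (w - u) 1 = 0 := by nlinarith [sq_nonneg ((w - u) 0), sq_nonneg ((w - u) 1)]
    simp only [PiLp.sub_apply] at h0 h1
    ext i
    fin_cases i
    · show u 0 = w 0
      linarith
    · show u 1 = w 1
      linarith
  set ψ := chartHomeo u (w - u) hd with hψ
  have hseg : ∀ a b, ψ '' segment ℝ a b = segment ℝ (ψ a) (ψ b) := chart_seg u (w - u) hd
  have hq : ∀ q : ℝ, ψ (q, 0) = u + q • (w - u) := by
    intro q
    ext i
    fin_cases i <;> simp [hψ, chartHomeo, chart]
  have hψ0 : ψ (0, 0) = u := by rw [hq]; simp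
  have hψ1 : ψ (1, 0) = w := by rw [hq]; simp
  have hpre : ∀ x y, ψ ⁻¹' segment ℝ x y = segment ℝ (ψ.symm x) (ψ.symm y) := by
    intro x y
    have := hseg (ψ.symm x) (ψ.symm y)
    rw [ψ.apply_symm_apply, ψ.apply_symm_apply] at this
    rw [← this, Set.preimage_image_eq _ ψ.injective]
  have hsees : ∀ a b, Sees (ψ ⁻¹' P) a b ↔ segment ℝ (ψ a) (ψ b) ⊆ P := by
    intro a b
    rw [← hseg, Set.image_subset_iff]
    rfl
  have hintr : ψ ⁻¹' (interior P) = interior (ψ ⁻¹' P) := ψ.preimage_interior P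
  have hfro : ψ ⁻¹' (frontier P) = frontier (ψ ⁻¹' P) := ψ.preimage_frontier P
  obtain ⟨G', hG1, hG2, hG3⟩ := poly_core (K := ψ ⁻¹' P) (v := fun i => ψ.symm (v i)) hn
    (ψ.symm.injective.comp hinj) (ψ.isCompact_preimage.2 hc)
    (by rw [← hintr, ← ψ.preimage_closure, ← hreg])
    (by
      rw [← hfro, hfr, Set.preimage_iUnion]
      exact Set.iUnion_congr fun i => hpre _ _)
    (by
      intro i
      rw [← hpre, ← hpre, ← Set.preimage_inter, hcon]
      ext z
      constructor
      · intro hz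
        have hz' : ψ z = v (i + 1) := hz
        show z = ψ.symm (v (i + 1))
        rw [← hz', ψ.symm_apply_apply]
      · intro hz
        have hz' : z = ψ.symm (v (i + 1)) := hz
        show ψ z = v (i + 1)
        rw [hz', ψ.apply_symm_apply])
    (by
      intro i j h1 h2 h3
      rw [← hpre, ← hpre]
      exact (hdis i j h1 h2 h3).preimage ψ)
    (by
      show ψ (0, 0) ∈ P
      rw [hψ0]; exact hPcl.frontier_subset hu)
    (by
      show ψ (1, 0) ∈ P
      rw [hψ1]; exact hPcl.frontier_subset hw)
    (by
      intro q h1 h2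
      rw [← hintr]
      apply hchord
      refine ⟨?_, ?_⟩
      · rw [hq]
        refine ⟨1 - q, q, by linarith, h1.le, by ring, ?_⟩
        module
      · rintro (h | h)
        · rw [← hψ0] at h
          have := congrArg Prod.fst (ψ.injective h)
          simp at this
          linarith
        · have h' : ψ (q, 0) = w := h
          rw [← hψ1] at h'
          have := congrArg Prod.fst (ψ.injective h')
          simp at this
          linarith)
    (by
      intro p hp
      obtain ⟨q, ⟨s, t, hs, ht, hst, rfl⟩, hqp⟩ := hwv (ψ p) hp
      refine ⟨t, ht, by linarith, ?_⟩
      rw [hsees, segment_symm, hq]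
      have : u + t • (w - u) = s • u + t • w := by
        obtain rfl : s = 1 - t := by linarith
        module
      rw [this]
      exact hqp)
    (G.image ψ.symm)
    (by
      intro g hg
      obtain ⟨x, hx, rfl⟩ := Finset.mem_image.1 hg
      rw [← hfro]
      show ψ (ψ.symm x) ∈ frontier P
      rw [ψ.apply_symm_apply]
      exact hG_bd hx)
    (by
      intro x hx
      rw [← hfro] at hx
      obtain ⟨g, hg, hgx⟩ := hG_guards (ψ x) hx
      refine ⟨ψ.symm g, Finset.mem_image_of_mem _ hg, ?_⟩
      rw [hsees, ψ.apply_symm_apply]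
      exact hgx)
  refine ⟨G'.image ψ, ?_, ?_, ?_⟩
  · intro x hx
    obtain ⟨g, hg, rfl⟩ := Finset.mem_image.1 (Finset.mem_coe.1 hx)
    rcases hG1 g hg with ⟨i, rfl⟩ | rfl | rfl
    · left
      exact ⟨i, (ψ.apply_symm_apply _).symm⟩
    · right; left; exact hψ0
    · right; right; exact hψ1
  · calc (G'.image ψ).card ≤ G'.card := Finset.card_image_le
      _ ≤ 2 * (G.image ψ.symm).card := hG2
      _ ≤ 2 * G.card := Nat.mul_le_mul_left 2 Finset.card_image_le
  · intro p hp
    obtain ⟨g, hg, hgp⟩ := hG3 (ψ.symm p) (by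
      show ψ (ψ.symm p) ∈ P
      rw [ψ.apply_symm_apply]; exact hp)
    rw [hsees, ψ.apply_symm_apply] at hgp
    refine ⟨ψ g, ?_, hgp⟩
    rcases hg with hg | hg
    · left
      obtain ⟨x, hx, rfl⟩ := Finset.mem_image.1 hg
      rw [ψ.apply_symm_apply]
      exact hx
    · right
      exact Finset.mem_coe.2 (Finset.mem_image_of_mem _ hg)
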